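/- Almost everywhere regularity of the space-time potential on the time-1 slice (Proposition 5.3). In the setting described in the context, H^d-almost every point of the hyperplane {1} × ℝ^d is regular for φ̄, i.e. H^d( ({1} × ℝ^d) \ R ) = 0, where H^d is the d-dimensional Hausdorff measure on ℝ × ℝ^d. -/

import Mathlib

open MeasureTheory Set Classical

noncomputable section

/-- Space-time `ℝ × ℝ^d`. -/
abbrev Spt (d : ℕ) := ℝ × EuclideanSpace ℝ (Fin d)

/-- The extended (space-time) cost associated to a convex nonnegative cost `c`:
`c̄(t,x) = t · c(-x/t)` for `t > 0`, `c̄(0,0) = 0`, `c̄(0,x) = ∞` for `x ≠ 0`,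
`c̄(t,x) = ∞` for `t < 0`. -/
def cbar {d : ℕ} (c : EuclideanSpace ℝ (Fin d) → ℝ) : Spt d → ENNReal := fun z =>
  if 0 < z.1 then ENNReal.ofReal (z.1 * c (-(z.1⁻¹ • z.2)))
  else if z.1 = 0 ∧ z.2 = 0 then 0 else ⊤

/-- The domain `D = [0,∞) × ℝ^d`. -/
def Dom (d : ℕ) : Set (Spt d) := {z | 0 ≤ z.1}

/-- The cone sub-differential `∂⁻φ̄(z) = {z' ∈ D : φ̄(z) − φ̄(z') = c̄(z − z') < ∞}`. -/
def sdMinus {d : ℕ} (c : EuclideanSpace ℝ (Fin d) → ℝ) (φ : Spt d → ℝ) (z : Spt d) :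
    Set (Spt d) :=
  {z' | z' ∈ Dom d ∧ cbar c (z - z') ≠ ⊤ ∧
    ((φ z - φ z' : ℝ) : EReal) = (cbar c (z - z') : EReal)}

/-- The cone super-differential `∂⁺φ̄(z) = {z' ∈ D : φ̄(z') − φ̄(z) = c̄(z' − z) < ∞}`. -/
def sdPlus {d : ℕ} (c : EuclideanSpace ℝ (Fin d) → ℝ) (φ : Spt d → ℝ) (z : Spt d) :
    Set (Spt d) :=
  {z' | z' ∈ Dom d ∧ cbar c (z' - z) ≠ ⊤ ∧
    ((φ z' - φ z : ℝ) : EReal) = (cbar c (z' - z) : EReal)}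

/-- The backward transport set `T⁻ = {z : ∂⁻φ̄(z) ≠ {z}}`. -/
def Tminus {d : ℕ} (c : EuclideanSpace ℝ (Fin d) → ℝ) (φ : Spt d → ℝ) : Set (Spt d) :=
  {z | sdMinus c φ z ≠ {z}}

/-- The forward transport set `T⁺ = {z : ∂⁺φ̄(z) ≠ {z}}`. -/
def Tplus {d : ℕ} (c : EuclideanSpace ℝ (Fin d) → ℝ) (φ : Spt d → ℝ) : Set (Spt d) :=
  {z | sdPlus c φ z ≠ {z}}

/-- The backward direction set `𝒟⁻φ̄(z) = {(z − z')/(t − t') : z' ∈ ∂⁻φ̄(z), z' ≠ z}`. -/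
def DirMinus {d : ℕ} (c : EuclideanSpace ℝ (Fin d) → ℝ) (φ : Spt d → ℝ) (z : Spt d) :
    Set (Spt d) :=
  {v | ∃ z' ∈ sdMinus c φ z, z' ≠ z ∧ v = (z.1 - z'.1)⁻¹ • (z - z')}

/-- The forward direction set `𝒟⁺φ̄(z) = {(z' − z)/(t' − t) : z' ∈ ∂⁺φ̄(z), z' ≠ z}`. -/
def DirPlus {d : ℕ} (c : EuclideanSpace ℝ (Fin d) → ℝ) (φ : Spt d → ℝ) (z : Spt d) :
    Set (Spt d) :=
  {v | ∃ z' ∈ sdPlus c φ z, z' ≠ z ∧ v = (z'.1 - z.1)⁻¹ • (z' - z)}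

/-- The cone `F⁻(z) = ℝ≥0 · conv(𝒟⁻φ̄(z))`. -/
def Fminus {d : ℕ} (c : EuclideanSpace ℝ (Fin d) → ℝ) (φ : Spt d → ℝ) (z : Spt d) :
    Set (Spt d) :=
  {v | ∃ r : ℝ, 0 ≤ r ∧ ∃ w ∈ convexHull ℝ (DirMinus c φ z), v = r • w}

/-- The cone `F⁺(z) = ℝ≥0 · conv(𝒟⁺φ̄(z))`. -/
def Fplus {d : ℕ} (c : EuclideanSpace ℝ (Fin d) → ℝ) (φ : Spt d → ℝ) (z : Spt d) :
    Set (Spt d) :=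
  {v | ∃ r : ℝ, 0 ≤ r ∧ ∃ w ∈ convexHull ℝ (DirPlus c φ z), v = r • w}

/-- Affine dimension of a set: the dimension of the direction of its affine span. -/
def adim {d : ℕ} (s : Set (Spt d)) : ℕ :=
  Module.finrank ℝ (affineSpan ℝ s).direction

/-- The set `R^{−,h}` of backward regular points of dimension `h`. -/
def RminusH {d : ℕ} (c : EuclideanSpace ℝ (Fin d) → ℝ) (φ : Spt d → ℝ) (h : ℕ) :
    Set (Spt d) :=
  {z | z ∈ Tminus c φ ∧ Convex ℝ (DirMinus c φ z) ∧ adim (DirMinus c φ z) = h ∧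
    ∃ z', z' ∈ Tminus c φ ∧ z' - z ∈ intrinsicInterior ℝ (Fminus c φ z) ∧
      z ∈ sdMinus c φ z' ∧ Convex ℝ (DirMinus c φ z') ∧ adim (DirMinus c φ z') = h}

/-- The set `R^{+,h}` of forward regular points of dimension `h`. -/
def RplusH {d : ℕ} (c : EuclideanSpace ℝ (Fin d) → ℝ) (φ : Spt d → ℝ) (h : ℕ) :
    Set (Spt d) :=
  {z | z ∈ Tplus c φ ∧ Convex ℝ (DirPlus c φ z) ∧ adim (DirPlus c φ z) = h ∧
    ∃ z', z' ∈ Tplus c φ ∧ z - z' ∈ intrinsicInterior ℝ (Fplus c φ z) ∧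
      z ∈ sdPlus c φ z' ∧ Convex ℝ (DirPlus c φ z') ∧ adim (DirPlus c φ z') = h}

/-- The regular set `R = (⋃_{h ≤ d} R^{−,h}) ∩ (⋃_{h ≤ d} R^{+,h})`. -/
def Rreg {d : ℕ} (c : EuclideanSpace ℝ (Fin d) → ℝ) (φ : Spt d → ℝ) : Set (Spt d) :=
  (⋃ h ∈ Finset.range (d + 1), RminusH c φ h) ∩ (⋃ h ∈ Finset.range (d + 1), RplusH c φ h)

section VolumeDistortion

variable {E : Type*} [NormedAddCommGroup E] [InnerProductSpace ℝ E]

/-- `y` minimises the Hopf–Lax functional `y ↦ f y + h (x - y)`. -/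
def HLMin (f h : E → ℝ) (x y : E) : Prop := ∀ y', f y + h (x - y) ≤ f y' + h (x - y')

lemma mix_strict {f h : E → ℝ} (hh : StrictConvexOn ℝ univ h) {l : ℝ} (hl0 : 0 < l) (hl1 : l < 1)
    {x₁ x₂ y₁ y₂ : E} (hq : y₁ + l • (x₁ - y₁) = y₂ + l • (x₂ - y₂)) (hne : y₁ ≠ y₂)
    (h1 : f y₁ + h (x₁ - y₁) ≤ f y₂ + h (x₁ - y₂)) : f y₁ + l * h (x₁ - y₁) < f y₂ + l * h (x₂ - y₂) := by
  have e : x₁ - y₂ = (1 - l) • (x₁ - y₁) + l • (x₂ - y₂) := by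
    have : l • (x₂ - y₂) = y₁ + l • (x₁ - y₁) - y₂ := by rw [hq]; abel
    rw [this, sub_smul, one_smul]; abel
  have hne' : x₁ - y₁ ≠ x₂ - y₂ := by
    intro h'
    rw [h'] at hq
    exact hne (add_right_cancel hq)
  have := hh.2 (mem_univ (x₁ - y₁)) (mem_univ (x₂ - y₂)) hne' (sub_pos.2 hl1) hl0 (by ring)
  rw [← e] at this
  simp only [smul_eq_mul] at this
  nlinarith

variable [FiniteDimensional ℝ E] [MeasurableSpace E] [BorelSpace E]
  (μ : Measure E) [μ.IsAddHaarMeasure]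

lemma volume_finset_le (Y : Finset E) {f h : E → ℝ} (hh : StrictConvexOn ℝ univ h)
    (hc : Continuous h) {l : ℝ} (hl0 : 0 < l) (hl1 : l < 1) {U : Set E} (hU : MeasurableSet U) :
    ENNReal.ofReal (l ^ Module.finrank ℝ E) *
      μ {x | ∃ y ∈ Y, (∀ y' ∈ Y, f y + h (x - y) ≤ f y' + h (x - y')) ∧ y + l • (x - y) ∈ U} ≤
      μ U := by
  set P : E → Set E := fun y =>
    {x | (∀ y' ∈ Y, f y + h (x - y) ≤ f y' + h (x - y')) ∧ y + l • (x - y) ∈ U} with hP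
  have hset : {x | ∃ y ∈ Y, (∀ y' ∈ Y, f y + h (x - y) ≤ f y' + h (x - y')) ∧
      y + l • (x - y) ∈ U} = ⋃ y ∈ Y, P y := by
    ext x; simp only [hP, mem_iUnion, mem_ofPred_eq, exists_prop]
  have hPm : ∀ y, MeasurableSet (P y) := by
    intro y
    have h1 : IsClosed {x | ∀ y' ∈ Y, f y + h (x - y) ≤ f y' + h (x - y')} := by
      simp only [ofPred_forall]
      exact isClosed_iInter fun y' => isClosed_iInter fun _ =>
        isClosed_le (by fun_prop) (by fun_prop)
    have h2 : MeasurableSet ((fun x => y + l • (x - y)) ⁻¹' U) :=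
      (by fun_prop : Continuous fun x => y + l • (x - y)).measurable hU
    exact h1.measurableSet.inter h2
  have himg : ∀ y, AffineMap.homothety y l '' P y =
      (fun q => y + l⁻¹ • (q - y)) ⁻¹' P y := by
    intro y
    refine congrFun (image_eq_preimage_of_inverse ?_ ?_) _ <;> intro x <;>
      simp [AffineMap.homothety_apply, smul_smul, hl0.ne']
  have hm : ∀ y ∈ Y, MeasurableSet (AffineMap.homothety y l '' P y) := by
    intro y _
    rw [himg]
    exact (by fun_prop : Continuous fun q => y + l⁻¹ • (q - y)).measurable (hPm y)
  have hap : ∀ y x : E, AffineMap.homothety y l x = y + l • (x - y) := by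
    intro y x; simp [AffineMap.homothety_apply, add_comm]
  have hdisj : (Y : Set E).PairwiseDisjoint fun y => AffineMap.homothety y l '' P y := by
    intro y₁ hy₁ y₂ hy₂ hne
    refine Set.disjoint_left.2 ?_
    rintro q ⟨x₁, hx₁, rfl⟩ ⟨x₂, hx₂, hq⟩
    rw [hap, hap] at hq
    have a := mix_strict hh hl0 hl1 hq.symm hne (hx₁.1 y₂ hy₂)
    have b := mix_strict hh hl0 hl1 hq hne.symm (hx₂.1 y₁ hy₁)
    exact lt_asymm a b
  calc _ ≤ ENNReal.ofReal (l ^ Module.finrank ℝ E) * ∑ y ∈ Y, μ (P y) := by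
        rw [hset]; gcongr; exact measure_biUnion_finset_le _ _
    _ = ∑ y ∈ Y, μ (AffineMap.homothety y l '' P y) := by
        rw [Finset.mul_sum]
        refine Finset.sum_congr rfl fun y _ => ?_
        rw [Measure.addHaar_image_homothety, abs_of_pos (by positivity)]
    _ = μ (⋃ y ∈ Y, AffineMap.homothety y l '' P y) := (measure_biUnion_finset hdisj hm).symm
    _ ≤ μ U := by
        refine measure_mono (iUnion₂_subset fun y _ => ?_)
        rintro _ ⟨x, hx, rfl⟩
        rw [hap]; exact hx.2

lemma mul_measure_le_of_eventually {α : Type*} [MeasurableSpace α] (μ : Measure α) {c b : ENNReal}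
    {A : Set α} {S : ℕ → Set α} (hA : ∀ x ∈ A, ∃ N, ∀ n ≥ N, x ∈ S n)
    (hS : ∀ n, c * μ (S n) ≤ b) : c * μ A ≤ b := by
  have hmono : Monotone fun N => ⋂ n ≥ N, S n := by
    intro N N' h
    exact iInter₂_mono' fun n hn => ⟨n, le_trans h hn, subset_rfl⟩
  calc c * μ A ≤ c * μ (⋃ N, ⋂ n ≥ N, S n) := by
        gcongr
        intro x hx
        simpa using hA x hx
    _ ≤ b := by
        rw [hmono.measure_iUnion, ENNReal.mul_iSup]
        refine iSup_le fun N => le_trans ?_ (hS N)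
        gcongr
        exact iInter₂_subset N le_rfl

lemma volume_open_le_of_strictConvex {f h : E → ℝ} (hf : Continuous f)
    (hh : StrictConvexOn ℝ univ h) (hc : Continuous h)
    (hcoer : ∀ x R, Bornology.IsBounded {y | f y + h (x - y) ≤ R})
    {l : ℝ} (hl0 : 0 < l) (hl1 : l < 1) {A U : Set E} (hU : IsOpen U)
    (hA : ∀ x ∈ A, ∀ y, HLMin f h x y → y + l • (x - y) ∈ U) :
    ENNReal.ofReal (l ^ Module.finrank ℝ E) * μ A ≤ μ U := by
  set u := TopologicalSpace.denseSeq E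
  refine mul_measure_le_of_eventually μ (S := fun N =>
    {x | ∃ y ∈ (Finset.range (N + 1)).image u, (∀ y' ∈ (Finset.range (N + 1)).image u,
      f y + h (x - y) ≤ f y' + h (x - y')) ∧ y + l • (x - y) ∈ U}) ?_
    fun n => volume_finset_le μ _ hh hc hl0 hl1 hU.measurableSet
  intro x hx
  set C : ℕ → Set E := fun N =>
    {y | ∀ i ≤ N, f y + h (x - y) ≤ f (u i) + h (x - u i)} ∩ {y | y + l • (x - y) ∈ Uᶜ} with hC
  have hcl : ∀ N, IsClosed (C N) := by
    intro N
    refine IsClosed.inter ?_ (hU.isClosed_compl.preimage (by fun_prop))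
    simp only [ofPred_forall]
    exact isClosed_iInter fun i => isClosed_iInter fun _ =>
        isClosed_le (by fun_prop) (by fun_prop)
  have hK : IsCompact (C 0) := by
    refine Metric.isCompact_of_isClosed_isBounded (hcl 0)
      ((hcoer x (f (u 0) + h (x - u 0))).subset fun y hy => hy.1 0 le_rfl)
  obtain ⟨N, hN⟩ : ∃ N, C N = ∅ := by
    by_contra! hne
    obtain ⟨y, hy⟩ := IsCompact.nonempty_iInter_of_sequence_nonempty_isCompact_isClosed C
      (fun N y hy => ⟨fun i hi => hy.1 i (by omega), hy.2⟩)
      hne hK hcl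
    rw [mem_iInter] at hy
    refine (hy 0).2 (hA x hx y ?_)
    intro y'
    have hcl' : IsClosed {y' | f y + h (x - y) ≤ f y' + h (x - y')} :=
      isClosed_le (by fun_prop) (by fun_prop)
    have : closure (range u) ⊆ {y' | f y + h (x - y) ≤ f y' + h (x - y')} := by
      refine hcl'.closure_subset_iff.2 ?_
      rintro _ ⟨i, rfl⟩
      exact (hy i).1 i le_rfl
    exact this (TopologicalSpace.denseRange_denseSeq E y')
  refine ⟨N, fun n hn => ?_⟩
  obtain ⟨y, hy, hymin⟩ := ((Finset.range (n + 1)).image u).exists_min_image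
    (fun y => f y + h (x - y)) ((Finset.nonempty_range_add_one).image u)
  refine ⟨y, hy, hymin, ?_⟩
  by_contra hyU
  have : y ∈ C N := ⟨fun i hi => hymin _ (Finset.mem_image_of_mem u (by simp; omega)), hyU⟩
  rw [hN] at this
  exact this

omit [FiniteDimensional ℝ E] [MeasurableSpace E] [BorelSpace E] in
lemma strictConvexOn_add_mul_norm_sub_sq {h : E → ℝ} (hh : ConvexOn ℝ univ h) {ε : ℝ} (hε : 0 < ε)
    (w : E) : StrictConvexOn ℝ univ fun a => h a + ε * ‖a - w‖ ^ 2 := by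
  refine ⟨convex_univ, fun a _ b _ hab s t hs ht hst => ?_⟩
  have h1 := hh.2 (mem_univ a) (mem_univ b) hs.le ht.le hst
  obtain rfl : t = 1 - s := by linarith
  have e : s • a + (1 - s) • b - w = s • (a - w) + (1 - s) • (b - w) := by module
  have h2 : ‖s • (a - w) + (1 - s) • (b - w)‖ ^ 2 =
      s * ‖a - w‖ ^ 2 + (1 - s) * ‖b - w‖ ^ 2 - s * (1 - s) * ‖a - b‖ ^ 2 := by
    have e2 : a - b = (a - w) - (b - w) := by abel
    rw [e2, norm_add_sq_real, norm_sub_sq_real (a - w) (b - w), norm_smul, norm_smul,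
      real_inner_smul_left, real_inner_smul_right, mul_pow, mul_pow]
    simp only [Real.norm_eq_abs, sq_abs]
    ring
  have h3 : 0 < ‖a - b‖ := norm_pos_iff.2 (sub_ne_zero.2 hab)
  have h4 : 0 < ε * (s * (1 - s) * ‖a - b‖ ^ 2) := by positivity
  simp only [smul_eq_mul] at h1 ⊢
  rw [e, h2]
  nlinarith

/-- Quantitative non-collapse of Hopf–Lax minimisers: moving every point of `A` a fraction of the
way towards its minimisers (only those closest to the drift `w` need to be considered) shrinks
volume by at most the factor of the corresponding homothety. -/
theorem mul_measure_le_of_HLMin {f h : E → ℝ} (hf : Continuous f) {m : ℝ} (hm : ∀ y, m ≤ f y)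
    (hh : ConvexOn ℝ univ h) (h0 : ∀ a, 0 ≤ h a) (hc : Continuous h) (w : E)
    {l : ℝ} (hl0 : 0 < l) (hl1 : l < 1) {A B : Set E}
    (hex : ∀ x ∈ A, ∃ y, HLMin f h x y)
    (hA : ∀ x ∈ A, ∀ y, HLMin f h x y → (∀ y', HLMin f h x y' → ‖x - y - w‖ ≤ ‖x - y' - w‖) →
      y + l • (x - y) ∈ B) :
    ENNReal.ofReal (l ^ Module.finrank ℝ E) * μ A ≤ μ B := by
  rw [B.measure_eq_iInf_isOpen μ]
  refine le_iInf₂ fun U hBU => le_iInf fun hU => ?_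
  set ε : ℕ → ℝ := fun n => 1 / ((n : ℝ) + 1) with hεdef
  have hε : ∀ n, 0 < ε n := fun n => Nat.one_div_pos_of_nat
  set hn : ℕ → E → ℝ := fun n a => h a + ε n * ‖a - w‖ ^ 2 with hhn
  have hbd : ∀ (x : E) (R : ℝ), Bornology.IsBounded {y | ‖x - y - w‖ ≤ R} := by
    intro x R
    refine (Metric.isBounded_closedBall (x := x - w) (r := R)).subset fun y hy => ?_
    have e : y - (x - w) = -(x - y - w) := by abel
    rw [mem_closedBall_iff_norm, e, norm_neg]
    exact hy
  refine mul_measure_le_of_eventually μ (S := fun n =>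
    {x | ∀ y, HLMin f (hn n) x y → y + l • (x - y) ∈ U}) ?_ fun n => ?_
  · intro x hx
    obtain ⟨z, hz⟩ := hex x hx
    set C : ℕ → Set E := fun n => {y | ∀ y', HLMin f h x y' → ‖x - y - w‖ ≤ ‖x - y' - w‖ ∧
      f y + h (x - y) ≤ f y' + h (x - y') + ε n * ‖x - y' - w‖ ^ 2} ∩
        {y | y + l • (x - y) ∈ Uᶜ} with hC
    have hcl : ∀ n, IsClosed (C n) := by
      intro n
      refine IsClosed.inter ?_ (hU.isClosed_compl.preimage (by fun_prop))
      simp only [ofPred_forall, ofPred_and]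
      exact isClosed_iInter fun i => isClosed_iInter fun _ =>
        (isClosed_le (by fun_prop) (by fun_prop)).inter (isClosed_le (by fun_prop) (by fun_prop))
    have hK : IsCompact (C 0) :=
      Metric.isCompact_of_isClosed_isBounded (hcl 0)
        ((hbd x ‖x - z - w‖).subset fun y hy => (hy.1 z hz).1)
    have hanti : ∀ i j, i ≤ j → C j ⊆ C i := by
      intro i j hij y hy
      refine ⟨fun y' hy' => ⟨(hy.1 y' hy').1, (hy.1 y' hy').2.trans ?_⟩, hy.2⟩
      have : ε j ≤ ε i := Nat.one_div_le_one_div hij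
      gcongr
    obtain ⟨N, hN⟩ : ∃ N, C N = ∅ := by
      by_contra! hne
      obtain ⟨y, hy⟩ := IsCompact.nonempty_iInter_of_sequence_nonempty_isCompact_isClosed C
        (fun N => hanti _ _ N.le_succ) hne hK hcl
      rw [mem_iInter] at hy
      have hmin : HLMin f h x y := by
        intro y'
        refine le_trans ?_ (hz y')
        have ht : Filter.Tendsto (fun n => f z + h (x - z) + ε n * ‖x - z - w‖ ^ 2) Filter.atTop
            (nhds (f z + h (x - z) + 0 * ‖x - z - w‖ ^ 2)) :=
          (tendsto_one_div_add_atTop_nhds_zero_nat.mul_const _).const_add _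
        rw [zero_mul, add_zero] at ht
        exact ge_of_tendsto' ht fun n => ((hy n).1 z hz).2
      exact (hy 0).2 (hBU (hA x hx y hmin fun y' hy' => ((hy 0).1 y' hy').1))
    refine ⟨N, fun n hnN y hy => ?_⟩
    by_contra hyU
    have : y ∈ C n := by
      refine ⟨fun y' hy' => ?_, hyU⟩
      have h1 := hy y'
      have h2 := hy' y
      simp only [hhn] at h1
      have h3 : 0 ≤ ε n * ‖x - y - w‖ ^ 2 := by have := hε n; positivity
      refine ⟨?_, by linarith⟩
      have h4 : ε n * ‖x - y - w‖ ^ 2 ≤ ε n * ‖x - y' - w‖ ^ 2 := by linarith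
      exact (sq_le_sq₀ (norm_nonneg _) (norm_nonneg _)).1 (le_of_mul_le_mul_left h4 (hε n))
    have := hanti N n hnN this
    rw [hN] at this
    exact this
  · refine volume_open_le_of_strictConvex μ hf
      (strictConvexOn_add_mul_norm_sub_sq hh (hε n) w) (by fun_prop) ?_ hl0 hl1 hU fun x hx => hx
    intro x R
    refine (hbd x (1 + (R - m) / ε n)).subset fun y hy => ?_
    have h1 := hm y
    have h2 := h0 (x - y)
    simp only [mem_ofPred_eq] at hy
    have h3 : ‖x - y - w‖ ^ 2 ≤ (R - m) / ε n := by
      rw [le_div_iff₀ (hε n)]; linarith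
    simp only [mem_ofPred_eq]
    nlinarith [sq_nonneg (‖x - y - w‖ - 1)]

end VolumeDistortion

section RelativeInterior

variable {E : Type*} [NormedAddCommGroup E] [NormedSpace ℝ E]

lemma mem_intrinsicInterior_iff_nhdsWithin {s : Set E} {x : E} :
    x ∈ intrinsicInterior ℝ s ↔ x ∈ affineSpan ℝ s ∧ s ∈ nhdsWithin x (affineSpan ℝ s) := by
  rw [mem_intrinsicInterior]
  constructor
  · rintro ⟨y, hy, rfl⟩
    exact ⟨y.2, preimage_coe_mem_nhds_subtype.1 (mem_interior_iff_mem_nhds.1 hy)⟩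
  · rintro ⟨hx, hs⟩
    exact ⟨⟨x, hx⟩, mem_interior_iff_mem_nhds.2 (preimage_coe_mem_nhds_subtype.2 hs), rfl⟩

lemma eventually_mem_intrinsicInterior {s : Set E} {x : E} (hx : x ∈ intrinsicInterior ℝ s) :
    ∀ᶠ y in nhdsWithin x (affineSpan ℝ s), y ∈ intrinsicInterior ℝ s := by
  obtain ⟨-, hs⟩ := mem_intrinsicInterior_iff_nhdsWithin.1 hx
  filter_upwards [eventually_eventually_nhdsWithin.2 hs, self_mem_nhdsWithin] with y hy hy'
  exact mem_intrinsicInterior_iff_nhdsWithin.2 ⟨hy', hy⟩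

lemma exists_ball_inter_subset_intrinsicInterior {s : Set E} {x : E}
    (hx : x ∈ intrinsicInterior ℝ s) :
    ∃ r > 0, ∀ y ∈ s, dist y x < r → y ∈ intrinsicInterior ℝ s := by
  obtain ⟨r, hr, h⟩ := Metric.mem_nhdsWithin_iff.1 (eventually_mem_intrinsicInterior hx)
  exact ⟨r, hr, fun y hy hyx => h ⟨hyx, subset_affineSpan ℝ s hy⟩⟩

lemma exists_extend_of_mem_intrinsicInterior {s : Set E} {u v : E}
    (hu : u ∈ intrinsicInterior ℝ s) (hv : v ∈ s) : ∃ ε : ℝ, 0 < ε ∧ u + ε • (u - v) ∈ s := by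
  obtain ⟨hus, hs⟩ := mem_intrinsicInterior_iff_nhdsWithin.1 hu
  have ht : Filter.Tendsto (fun ε : ℝ => u + ε • (u - v)) (nhdsWithin 0 (Ioi 0))
      (nhdsWithin u (affineSpan ℝ s)) := by
    refine tendsto_nhdsWithin_iff.2 ⟨?_, Filter.Eventually.of_forall fun ε => ?_⟩
    · refine Filter.Tendsto.mono_left ?_ nhdsWithin_le_nhds
      have : Continuous fun ε : ℝ => u + ε • (u - v) := by fun_prop
      simpa using this.tendsto 0
    · have := AffineSubspace.vadd_mem_of_mem_direction ((affineSpan ℝ s).direction.smul_mem ε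
        (AffineSubspace.vsub_mem_direction hus (subset_affineSpan ℝ s hv))) hus
      rw [vadd_eq_add, add_comm] at this
      exact this
  obtain ⟨ε, h1, h2⟩ := ((ht.eventually_mem hs).and self_mem_nhdsWithin).exists
  exact ⟨ε, h2, h1⟩

lemma convex_closure_of_forall_mem_closure {s : Set E}
    (h : ∀ x ∈ s, ∀ y ∈ s, ∀ a b : ℝ, 0 < a → 0 < b → a + b = 1 → a • x + b • y ∈ closure s) :
    Convex ℝ (closure s) := by
  rw [convex_iff_forall_pos]
  intro x hx y hy a b ha hb hab
  have := map_mem_closure₂ (f := fun x y : E => a • x + b • y) (u := closure s)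
    (by fun_prop) hx hy fun x hx y hy => h x hx y hy a b ha hb hab
  rwa [closure_closure] at this

end RelativeInterior

section Rays

variable {E : Type*} [NormedAddCommGroup E] [NormedSpace ℝ E]

/-- `u` is the velocity of an optimal ray of duration `τ` ending at `(t, x)`. -/
def BackDir (g : E → ℝ) (φ : ℝ → E → ℝ) (t : ℝ) (x : E) (τ : ℝ) (u : E) : Prop :=
  φ t x = φ (t - τ) (x - τ • u) + τ * g u

/-- `u` is the velocity of an optimal ray of duration `τ` starting at `(t, x)`. -/
def FwdDir (g : E → ℝ) (φ : ℝ → E → ℝ) (t : ℝ) (x : E) (τ : ℝ) (u : E) : Prop :=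
  φ (t + τ) (x + τ • u) = φ t x + τ * g u

/-- All backward velocities at `(t, x)`. -/
def backDirs (g : E → ℝ) (φ : ℝ → E → ℝ) (t : ℝ) (x : E) : Set E :=
  {u | ∃ τ, 0 < τ ∧ τ ≤ t ∧ BackDir g φ t x τ u}

/-- All forward velocities at `(t, x)`. -/
def fwdDirs (g : E → ℝ) (φ : ℝ → E → ℝ) (t : ℝ) (x : E) : Set E :=
  {u | ∃ τ, 0 < τ ∧ FwdDir g φ t x τ u}

/-- The properties of a Hopf–Lax evolution with Lagrangian `g` used below. -/
structure HopfLax (g : E → ℝ) (φ : ℝ → E → ℝ) : Prop where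
  conv : ConvexOn ℝ univ g
  nonneg : ∀ w, 0 ≤ g w
  cont : Continuous g
  sub : ∀ s τ : ℝ, 0 ≤ s → 0 < τ → ∀ y w, φ (s + τ) (y + τ • w) ≤ φ s y + τ * g w
  cont_slice : ∀ t, 0 ≤ t → Continuous (φ t)
  bdd : ∀ t, 0 ≤ t → ∃ m, ∀ x, |φ t x| ≤ m
  exists_back : ∀ t, 0 < t → ∀ x, ∃ u, BackDir g φ t x t u
  speed : ∀ t₀, 0 < t₀ → ∃ C, ∀ t, t₀ ≤ t → ∀ x u, BackDir g φ t x t u → ‖u‖ ≤ C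

variable {g : E → ℝ} {φ : ℝ → E → ℝ} {t τ σ δ : ℝ} {x u v w : E}

lemma FwdDir.backDir (h : FwdDir g φ t x τ u) : BackDir g φ (t + τ) (x + τ • u) τ u := by
  unfold BackDir
  rw [add_sub_cancel_right, add_sub_cancel_right]
  exact h

lemma BackDir.fwdDir (h : BackDir g φ t x τ u) : FwdDir g φ (t - τ) (x - τ • u) τ u := by
  unfold FwdDir
  rw [sub_add_cancel, sub_add_cancel]
  exact h

namespace HopfLax

variable (H : HopfLax g φ)
include H

lemma sub' {s : ℝ} (hs : 0 ≤ s) {t : ℝ} (hst : s < t) {y x : E} (w : E)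
    (hx : x = y + (t - s) • w) : φ t x ≤ φ s y + (t - s) * g w := by
  have := H.sub s (t - s) hs (sub_pos.2 hst) y w
  rwa [add_sub_cancel, ← hx] at this

lemma back_mono (h : BackDir g φ t x τ u) (hσ : 0 < σ) (hστ : σ ≤ τ) (hτ : τ ≤ t) :
    BackDir g φ t x σ u := by
  rcases hστ.eq_or_lt with rfl | hlt
  · exact h
  · have h1 := H.sub' (s := t - σ) (t := t) (by linarith) (by linarith)
      (y := x - σ • u) (x := x) u (by module)
    have h2 := H.sub' (s := t - τ) (t := t - σ) (by linarith) (by linarith)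
      (y := x - τ • u) (x := x - σ • u) u (by module)
    unfold BackDir at *
    linarith

lemma fwd_mono (h : FwdDir g φ t x τ u) (hσ : 0 < σ) (hστ : σ ≤ τ) (ht : 0 ≤ t) :
    FwdDir g φ t x σ u := by
  rcases hστ.eq_or_lt with rfl | hlt
  · exact h
  · have h1 := H.sub' (s := t) (t := t + σ) (by linarith) (by linarith)
      (y := x) (x := x + σ • u) u (by module)
    have h2 := H.sub' (s := t + σ) (t := t + τ) (by linarith) (by linarith)
      (y := x + σ • u) (x := x + τ • u) u (by module)
    unfold FwdDir at *
    linarith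

lemma back_step (h : BackDir g φ t x τ u) (hσ : 0 < σ) (hστ : σ < τ) (hτ : τ ≤ t) :
    BackDir g φ (t - σ) (x - σ • u) (τ - σ) u := by
  have h1 := H.back_mono h hσ hστ.le hτ
  unfold BackDir at *
  have e1 : t - σ - (τ - σ) = t - τ := by ring
  have e2 : x - σ • u - (τ - σ) • u = x - τ • u := by module
  rw [e1, e2]
  linarith

lemma concat (hw : FwdDir g φ t x δ w) (hv : BackDir g φ t x σ v) (hδ : 0 < δ) (hσ : 0 < σ)
    (hσt : σ ≤ t) :
    BackDir g φ (t + δ) (x + δ • w) (δ + σ) ((δ / (δ + σ)) • w + (σ / (δ + σ)) • v) ∧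
      g ((δ / (δ + σ)) • w + (σ / (δ + σ)) • v) = δ / (δ + σ) * g w + σ / (δ + σ) * g v := by
  have hs : 0 < δ + σ := by positivity
  set m := (δ / (δ + σ)) • w + (σ / (δ + σ)) • v with hm
  have e : (δ + σ) • m = δ • w + σ • v := by
    rw [hm, smul_add, smul_smul, smul_smul, mul_div_cancel₀ _ hs.ne', mul_div_cancel₀ _ hs.ne']
  have hc := H.conv.2 (mem_univ w) (mem_univ v)
    (show 0 ≤ δ / (δ + σ) by positivity) (show 0 ≤ σ / (δ + σ) by positivity) (by field_simp)
  simp only [smul_eq_mul] at hc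
  have h1 := H.sub' (s := t - σ) (t := t + δ) (by linarith) (by linarith)
      (y := x - σ • v) (x := x + δ • w) m (by
        have : (t + δ - (t - σ)) • m = δ • w + σ • v := by rw [← e]; congr 1; ring
        rw [this]; abel)
  have e1 : (δ + σ) * (δ / (δ + σ) * g w + σ / (δ + σ) * g v) = δ * g w + σ * g v := by
    field_simp
  have h2 : (δ + σ) * g m ≤ δ * g w + σ * g v := by
    rw [← e1]; exact mul_le_mul_of_nonneg_left hc hs.le
  have e2 : t + δ - (δ + σ) = t - σ := by ring
  have e3 : x + δ • w - (δ + σ) • m = x - σ • v := by rw [e]; abel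
  have e4 : t + δ - (t - σ) = δ + σ := by ring
  rw [e4] at h1
  unfold FwdDir at hw
  unfold BackDir at hv ⊢
  rw [e2, e3]
  have h3 : (δ + σ) * g m = δ * g w + σ * g v := by linarith
  refine ⟨by linarith, ?_⟩
  have := h3.trans e1.symm
  exact mul_left_cancel₀ hs.ne' this

lemma back_extremal (h : BackDir g φ t x τ u) (hτ : 0 < τ) (hτt : τ ≤ t) {a b : ℝ} (ha : 0 < a)
    (hb : 0 < b) (hab : a + b = 1) (hu : u = a • v + b • w) (hg : g u = a * g v + b * g w) :
    v ∈ backDirs g φ t x := by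
  obtain rfl : a = 1 - b := by linarith
  have h0 : 0 < (1 - b) * τ := by positivity
  have h0' : 0 < b * τ := by positivity
  refine ⟨(1 - b) * τ, h0, by nlinarith, ?_⟩
  have h1 := H.sub' (s := t - (1 - b) * τ) (t := t) (by nlinarith) (by linarith)
      (y := x - ((1 - b) * τ) • v) (x := x) v (by module)
  have h2 := H.sub' (s := t - τ) (t := t - (1 - b) * τ) (by linarith) (by linarith)
      (y := x - τ • u) (x := x - ((1 - b) * τ) • v) w (by rw [hu]; module)
  unfold BackDir at *
  rw [hg] at h
  linarith

lemma fwd_extremal (h : FwdDir g φ t x τ u) (hτ : 0 < τ) (ht : 0 ≤ t) {a b : ℝ} (ha : 0 < a)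
    (hb : 0 < b) (hab : a + b = 1) (hu : u = a • v + b • w) (hg : g u = a * g v + b * g w) :
    v ∈ fwdDirs g φ t x := by
  obtain rfl : a = 1 - b := by linarith
  have h0 : 0 < (1 - b) * τ := by positivity
  have h0' : 0 < b * τ := by positivity
  refine ⟨(1 - b) * τ, h0, ?_⟩
  have h1 := H.sub' (s := t) (t := t + (1 - b) * τ) (by linarith) (by linarith)
      (y := x) (x := x + ((1 - b) * τ) • v) v (by module)
  have h2 := H.sub' (s := t + (1 - b) * τ) (t := t + τ) (by linarith) (by linarith)
      (y := x + ((1 - b) * τ) • v) (x := x + τ • u) w (by rw [hu]; module)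
  unfold FwdDir at *
  rw [hg] at h
  linarith

lemma affine_mix (hw : w ∈ fwdDirs g φ t x) (hv : v ∈ backDirs g φ t x) {a b : ℝ} (ha : 0 < a)
    (hb : 0 < b) (hab : a + b = 1) : g (a • w + b • v) = a * g w + b * g v := by
  obtain ⟨δ, hδ, hw⟩ := hw
  obtain ⟨σ, hσ, hσt, hv⟩ := hv
  have hm : 0 < min δ σ := lt_min hδ hσ
  have h1 : a * min δ σ ≤ δ := (mul_le_of_le_one_left hm.le (by linarith)).trans (min_le_left _ _)
  have h2 : b * min δ σ ≤ σ := (mul_le_of_le_one_left hm.le (by linarith)).trans (min_le_right _ _)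
  have := (H.concat (H.fwd_mono hw (by positivity) h1 (by linarith))
    (H.back_mono hv (by positivity) h2 hσt) (by positivity) (by positivity) (by linarith)).2
  have e : a * min δ σ + b * min δ σ = min δ σ := by rw [← add_mul, hab, one_mul]
  rw [e, mul_div_cancel_right₀ _ hm.ne', mul_div_cancel_right₀ _ hm.ne'] at this
  exact this

end HopfLax

/-- Points where the backward and forward velocities form one and the same nonempty convex set. -/
def GoodPoint (g : E → ℝ) (φ : ℝ → E → ℝ) (t : ℝ) (x : E) : Prop :=
  backDirs g φ t x = fwdDirs g φ t x ∧ (backDirs g φ t x).Nonempty ∧ Convex ℝ (backDirs g φ t x)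

namespace HopfLax

variable (H : HopfLax g φ)
include H

theorem goodPoint_of_mix_mem_closure [FiniteDimensional ℝ E] (ht : 0 ≤ t)
    (hb : (backDirs g φ t x).Nonempty)
    (hf : (fwdDirs g φ t x).Nonempty)
    (hL : ∀ v ∈ backDirs g φ t x, ∀ w ∈ fwdDirs g φ t x, ∀ a b : ℝ, 0 < a → 0 < b → a + b = 1 →
      a • w + b • v ∈ closure (backDirs g φ t x ∩ fwdDirs g φ t x)) : GoodPoint g φ t x := by
  set I := backDirs g φ t x ∩ fwdDirs g φ t x with hI
  have hlim : ∀ v w : E, (∀ a b : ℝ, 0 < a → 0 < b → a + b = 1 → a • w + b • v ∈ closure I) →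
      w ∈ closure I := by
    intro v w h
    have hc : Filter.Tendsto (fun b : ℝ => (1 - b) • w + b • v) (nhdsWithin 0 (Ioi 0))
        (nhds w) := by
      refine Filter.Tendsto.mono_left ?_ nhdsWithin_le_nhds
      have : Continuous fun b : ℝ => (1 - b) • w + b • v := by fun_prop
      simpa using this.tendsto 0
    refine isClosed_closure.mem_of_tendsto hc ?_
    filter_upwards [Ioo_mem_nhdsGT (zero_lt_one' ℝ)] with b hb
    exact h _ _ (sub_pos.2 hb.2) hb.1 (by ring)
  obtain ⟨v₀, hv₀⟩ := hb
  obtain ⟨w₀, hw₀⟩ := hf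
  have hfK : fwdDirs g φ t x ⊆ closure I := fun w hw => hlim v₀ w (hL v₀ hv₀ w hw)
  have hbK : backDirs g φ t x ⊆ closure I := fun v hv => hlim w₀ v fun a b ha hb hab => by
    rw [add_comm]; exact hL v hv w₀ hw₀ b a hb ha (by linarith)
  have hconv : Convex ℝ (closure I) := convex_closure_of_forall_mem_closure
    fun x hx y hy a b ha hb hab => hL y hy.1 x hx.2 a b ha hb hab
  have haff : ∀ x ∈ closure I, ∀ y ∈ closure I, ∀ a b : ℝ, 0 < a → 0 < b → a + b = 1 →
      g (a • x + b • y) = a * g x + b * g y := by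
    intro x hx y hy a b ha hb hab
    have hg := H.cont
    have hcl : IsClosed {p : E × E | g (a • p.1 + b • p.2) = a * g p.1 + b * g p.2} :=
      isClosed_eq (by fun_prop) (by fun_prop)
    have hsub : I ×ˢ I ⊆ {p : E × E | g (a • p.1 + b • p.2) = a * g p.1 + b * g p.2} :=
      fun p hp => H.affine_mix hp.1.2 hp.2.1 ha hb hab
    have := hcl.closure_subset_iff.2 hsub
    rw [closure_prod_eq] at this
    exact this (mk_mem_prod hx hy)
  obtain ⟨k, hk⟩ := Set.Nonempty.intrinsicInterior hconv ⟨w₀, hfK hw₀⟩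
  obtain ⟨r, hr, hball⟩ := exists_ball_inter_subset_intrinsicInterior hk
  obtain ⟨u, huI, hur⟩ := Metric.mem_closure_iff.1 (intrinsicInterior_subset hk) r hr
  have hu := hball u (subset_closure huI) (by rwa [dist_comm])
  have hKI : closure I ⊆ I := by
    intro v hv
    obtain ⟨ε, hε, hε'⟩ := exists_extend_of_mem_intrinsicInterior hu hv
    have ha : 0 < ε / (1 + ε) := by positivity
    have hb : 0 < 1 / (1 + ε) := by positivity
    have hab : ε / (1 + ε) + 1 / (1 + ε) = 1 := by field_simp; ring
    have e : u = (ε / (1 + ε)) • v + (1 / (1 + ε)) • (u + ε • (u - v)) := by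
      match_scalars <;> field_simp
      ring
    have hg := haff v hv _ hε' _ _ ha hb hab
    rw [← e] at hg
    obtain ⟨⟨τ, h1, h2, h3⟩, ⟨σ, h4, h5⟩⟩ := huI
    exact ⟨H.back_extremal h3 h1 h2 ha hb hab e hg, H.fwd_extremal h5 h4 ht ha hb hab e hg⟩
  have e1 : backDirs g φ t x = I := (hbK.trans hKI).antisymm inter_subset_left
  have e2 : fwdDirs g φ t x = I := (hfK.trans hKI).antisymm inter_subset_right
  have e3 : closure I = I := hKI.antisymm subset_closure
  refine ⟨e1.trans e2.symm, ⟨v₀, hv₀⟩, ?_⟩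
  rw [e1, ← e3]
  exact hconv

/-- The common velocity set is constant along a ray joining two good points. -/
lemma backDirs_eq_of_ray (ht : 0 < t) (hδ : 0 < δ) (hw : FwdDir g φ t x δ w)
    (h1 : GoodPoint g φ t x) (h2 : GoodPoint g φ (t + δ) (x + δ • w)) :
    backDirs g φ (t + δ) (x + δ • w) = backDirs g φ t x := by
  apply Subset.antisymm
  · rw [h1.1, h2.1]
    rintro v ⟨τ, hτ, hv⟩
    obtain ⟨h3, h4⟩ := H.concat hv hw.backDir hτ hδ (by linarith)
    refine H.fwd_extremal (τ := τ + δ) ?_ (by linarith) ht.le (a := τ / (τ + δ)) (b := δ / (τ + δ))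
      (by positivity) (by positivity) (by field_simp) rfl h4
    have h5 := h3.fwdDir
    convert h5 using 1
    · ring
    · rw [smul_add, smul_smul, smul_smul, mul_div_cancel₀ _ (by positivity),
        mul_div_cancel₀ _ (by positivity)]
      abel
  · rintro v ⟨σ, hσ, hσt, hv⟩
    obtain ⟨h3, h4⟩ := H.concat hw hv hδ hσ hσt
    refine H.back_extremal h3 (by linarith) (by linarith) (a := σ / (δ + σ)) (b := δ / (δ + σ))
      (w := w) (by positivity) (by positivity) (by field_simp; ring) (add_comm _ _) ?_
    rw [h4]; ring

end HopfLax

end Rays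

section AlmostEverywhere

variable {E : Type*} [NormedAddCommGroup E] [InnerProductSpace ℝ E] [FiniteDimensional ℝ E]
  [MeasurableSpace E] [BorelSpace E] (μ : Measure E) [μ.IsAddHaarMeasure]
  {g : E → ℝ} {φ : ℝ → E → ℝ} {t τ σ δ : ℝ}

omit [FiniteDimensional ℝ E] [MeasurableSpace E] [BorelSpace E] in
lemma convexOn_mul_comp_smul (hg : ConvexOn ℝ univ g) (hτ : 0 ≤ τ) (r : ℝ) :
    ConvexOn ℝ univ fun a => τ * g (r • a) := by
  have := (hg.comp_linearMap (r • LinearMap.id : E →ₗ[ℝ] E)).smul hτ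
  simpa using this

namespace HopfLax

variable (H : HopfLax g φ)
include H

theorem mul_measure_le_back (hσ : 0 < σ) (hστ : σ < τ) (hτ : τ ≤ t) (w₀ : E) {A B : Set E}
    (hex : ∀ x ∈ A, ∃ u, BackDir g φ t x τ u)
    (hA : ∀ x ∈ A, ∀ u, BackDir g φ t x τ u →
      (∀ u', BackDir g φ t x τ u' → ‖u - w₀‖ ≤ ‖u' - w₀‖) → x - σ • u ∈ B) :
    ENNReal.ofReal (((τ - σ) / τ) ^ Module.finrank ℝ E) * μ A ≤ μ B := by
  have hτ0 : 0 < τ := hσ.trans hστ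
  obtain ⟨m, hm⟩ := H.bdd (t - τ) (by linarith)
  have hg := H.cont
  have hle : ∀ x y, φ t x ≤ φ (t - τ) y + τ * g (τ⁻¹ • (x - y)) := by
    intro x y
    have := H.sub' (s := t - τ) (t := t) (by linarith) (by linarith) (y := y) (x := x)
      (τ⁻¹ • (x - y)) (by rw [sub_sub_cancel, smul_inv_smul₀ hτ0.ne']; abel)
    rwa [sub_sub_cancel] at this
  have hmin : ∀ x u, BackDir g φ t x τ u →
      HLMin (φ (t - τ)) (fun a => τ * g (τ⁻¹ • a)) x (x - τ • u) := by
    intro x u hu y'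
    simp only [sub_sub_cancel, inv_smul_smul₀ hτ0.ne']
    exact hu.symm.le.trans (hle x y')
  refine mul_measure_le_of_HLMin μ (f := φ (t - τ)) (h := fun a => τ * g (τ⁻¹ • a))
    (H.cont_slice _ (by linarith)) (m := -m) (fun y => (abs_le.1 (hm y)).1)
    (convexOn_mul_comp_smul H.conv hτ0.le _)
    (fun a => mul_nonneg hτ0.le (H.nonneg _)) (by fun_prop) (τ • w₀)
    (div_pos (by linarith) hτ0) ((div_lt_one hτ0).2 (by linarith)) ?_ ?_
  · intro x hx
    obtain ⟨u, hu⟩ := hex x hx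
    exact ⟨_, hmin x u hu⟩
  · intro x hx y hy hnear
    obtain ⟨v, hv⟩ := hex x hx
    have hu : BackDir g φ t x τ (τ⁻¹ • (x - y)) := by
      have h1 := hy (x - τ • v)
      simp only [sub_sub_cancel, inv_smul_smul₀ hτ0.ne'] at h1
      unfold BackDir at hv ⊢
      rw [smul_inv_smul₀ hτ0.ne', sub_sub_cancel]
      exact (hle x y).antisymm (h1.trans hv.symm.le)
    have key := hA x hx _ hu fun u' hu' => ?_
    · convert key using 1
      match_scalars <;> field_simp
      ring
    · have h2 := hnear _ (hmin x u' hu')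
      have e1 : x - y - τ • w₀ = τ • (τ⁻¹ • (x - y) - w₀) := by
        rw [smul_sub, smul_inv_smul₀ hτ0.ne']
      have e2 : x - (x - τ • u') - τ • w₀ = τ • (u' - w₀) := by module
      rw [e1, e2, norm_smul, norm_smul] at h2
      exact le_of_mul_le_mul_left h2 (norm_pos_iff.2 hτ0.ne')

theorem mul_measure_le_fwd (ht : 0 ≤ t) (hσ : 0 < σ) (hστ : σ < τ) (w₀ : E) {A B : Set E}
    (hex : ∀ x ∈ A, ∃ u, FwdDir g φ t x τ u)
    (hA : ∀ x ∈ A, ∀ u, FwdDir g φ t x τ u →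
      (∀ u', FwdDir g φ t x τ u' → ‖u - w₀‖ ≤ ‖u' - w₀‖) → x + σ • u ∈ B) :
    ENNReal.ofReal (((τ - σ) / τ) ^ Module.finrank ℝ E) * μ A ≤ μ B := by
  have hτ0 : 0 < τ := hσ.trans hστ
  obtain ⟨m, hm⟩ := H.bdd (t + τ) (by linarith)
  have hg := H.cont
  have hφ := H.cont_slice (t + τ) (by linarith)
  have hle : ∀ x y, -φ t x ≤ -φ (t + τ) y + τ * g ((-τ⁻¹) • (x - y)) := by
    intro x y
    have := H.sub' (s := t) (t := t + τ) (by linarith) (by linarith) (y := x) (x := y)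
      ((-τ⁻¹) • (x - y)) (by match_scalars <;> field_simp <;> ring)
    rw [add_sub_cancel_left] at this
    linarith
  have e0 : ∀ x u : E, (-τ⁻¹) • (x - (x + τ • u)) = u := by
    intro x u
    match_scalars <;> field_simp
    ring
  have hmin : ∀ x u, FwdDir g φ t x τ u →
      HLMin (fun y => -φ (t + τ) y) (fun a => τ * g ((-τ⁻¹) • a)) x (x + τ • u) := by
    intro x u hu y'
    simp only [e0]
    unfold FwdDir at hu
    have := hle x y'
    linarith
  refine mul_measure_le_of_HLMin μ (f := fun y => -φ (t + τ) y)
    (h := fun a => τ * g ((-τ⁻¹) • a)) (by fun_prop) (m := -m)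
    (fun y => neg_le_neg (abs_le.1 (hm y)).2)
    (convexOn_mul_comp_smul H.conv hτ0.le _)
    (fun a => mul_nonneg hτ0.le (H.nonneg _)) (by fun_prop) (-(τ • w₀))
    (div_pos (by linarith) hτ0) ((div_lt_one hτ0).2 (by linarith)) ?_ ?_
  · intro x hx
    obtain ⟨u, hu⟩ := hex x hx
    exact ⟨_, hmin x u hu⟩
  · intro x hx y hy hnear
    obtain ⟨v, hv⟩ := hex x hx
    have ey : x + τ • ((-τ⁻¹) • (x - y)) = y := by
      match_scalars <;> field_simp
      ring
    have hu : FwdDir g φ t x τ ((-τ⁻¹) • (x - y)) := by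
      have h1 := hy (x + τ • v)
      have h2 := hle x y
      simp only [e0] at h1
      unfold FwdDir at hv ⊢
      rw [ey]
      linarith
    have key := hA x hx _ hu fun u' hu' => ?_
    · convert key using 1
      match_scalars <;> field_simp <;> ring
    · have h2 := hnear _ (hmin x u' hu')
      have e1 : x - y - -(τ • w₀) = (-τ) • ((-τ⁻¹) • (x - y) - w₀) := by
        match_scalars <;> field_simp
      have e2 : x - (x + τ • u') - -(τ • w₀) = (-τ) • (u' - w₀) := by module
      rw [e1, e2, norm_smul, norm_smul] at h2
      exact le_of_mul_le_mul_left h2 (norm_pos_iff.2 (neg_ne_zero.2 hτ0.ne'))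

end HopfLax

lemma isClosed_setOf_exists_mem_compact {X Y : Type*} [TopologicalSpace X] [TopologicalSpace Y]
    {B : Set Y} (hB : IsCompact B) {S : Set (X × Y)} (hS : IsClosed S) :
    IsClosed {x | ∃ u ∈ B, (x, u) ∈ S} := by
  have := isCompact_iff_compactSpace.1 hB
  have h1 : IsClosed ((fun p : X × B => (p.1, (p.2 : Y))) ⁻¹' S) := hS.preimage (by fun_prop)
  convert isClosedMap_fst_of_compactSpace _ h1 using 1
  ext x
  constructor
  · rintro ⟨u, hu, hx⟩
    exact ⟨(x, ⟨u, hu⟩), hx, rfl⟩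
  · rintro ⟨⟨x', u⟩, hx, rfl⟩
    exact ⟨u, u.2, hx⟩

lemma eq_zero_of_mul_add_le_cthickening {μ : Measure E} [IsFiniteMeasureOnCompacts μ] {K : Set E}
    (hK : IsCompact K) (C : ℝ) {c : ℝ → ℝ} (hc : Filter.Tendsto c (nhdsWithin 0 (Ioi 0)) (nhds 1))
    {b : ENNReal} (h : ∀ᶠ δ in nhdsWithin 0 (Ioi 0),
      ENNReal.ofReal (c δ) * μ K + b ≤ μ (Metric.cthickening (C * δ) K)) : b = 0 := by
  have h1 : Filter.Tendsto (fun δ : ℝ => μ (Metric.cthickening (C * δ) K))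
      (nhdsWithin 0 (Ioi 0)) (nhds (μ K)) := by
    refine (tendsto_measure_cthickening_of_isCompact hK).comp ?_
    refine Filter.Tendsto.mono_left ?_ nhdsWithin_le_nhds
    have : Continuous fun δ : ℝ => C * δ := by fun_prop
    simpa using this.tendsto 0
  have h2 : Filter.Tendsto (fun δ : ℝ => ENNReal.ofReal (c δ) * μ K + b)
      (nhdsWithin 0 (Ioi 0)) (nhds (ENNReal.ofReal 1 * μ K + b)) :=
    (ENNReal.Tendsto.mul_const (ENNReal.tendsto_ofReal hc) (Or.inr hK.measure_ne_top)).add_const b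
  have := le_of_tendsto_of_tendsto h2 h1 h
  rw [ENNReal.ofReal_one, one_mul] at this
  have h3 : μ K + b ≤ μ K + 0 := by simpa using this
  simpa using (ENNReal.add_le_add_iff_left hK.measure_ne_top).1 h3

namespace HopfLax

variable (H : HopfLax g φ)
include H

omit [MeasurableSpace E] [BorelSpace E] in
lemma isClosed_exists_fwdDir (ht : 0 ≤ t) (hτ : 0 ≤ τ) (w : E) (r : ℝ) :
    IsClosed {x | ∃ u ∈ Metric.closedBall w r, FwdDir g φ t x τ u} := by
  have h1 := H.cont_slice t ht
  have h2 := H.cont_slice (t + τ) (by linarith)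
  have h3 := H.cont
  exact isClosed_setOf_exists_mem_compact (isCompact_closedBall w r)
    (S := {p : E × E | φ (t + τ) (p.1 + τ • p.2) = φ t p.1 + τ * g p.2})
    (isClosed_eq (by fun_prop) (by fun_prop))

omit [MeasurableSpace E] [BorelSpace E] in
lemma isClosed_exists_backDir (hτ : 0 ≤ τ) (hτt : τ ≤ t) (w : E) (r : ℝ) :
    IsClosed {x | ∃ u ∈ Metric.closedBall w r, BackDir g φ t x τ u} := by
  have h1 := H.cont_slice t (by linarith)
  have h2 := H.cont_slice (t - τ) (by linarith)
  have h3 := H.cont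
  exact isClosed_setOf_exists_mem_compact (isCompact_closedBall w r)
    (S := {p : E × E | φ t p.1 = φ (t - τ) (p.1 - τ • p.2) + τ * g p.2})
    (isClosed_eq (by fun_prop) (by fun_prop))

omit [MeasurableSpace E] [BorelSpace E] in
lemma isClosed_exists_backDir_fwdDir (hτ : 0 ≤ τ) (hτt : τ ≤ t) (w : E) (r : ℝ) :
    IsClosed {x | ∃ u ∈ Metric.closedBall w r, BackDir g φ t x τ u ∧ FwdDir g φ t x τ u} := by
  have h0 := H.cont_slice (t + τ) (by linarith)
  have h1 := H.cont_slice t (by linarith)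
  have h2 := H.cont_slice (t - τ) (by linarith)
  have h3 := H.cont
  exact isClosed_setOf_exists_mem_compact (isCompact_closedBall w r)
    (S := {p : E × E | φ t p.1 = φ (t - τ) (p.1 - τ • p.2) + τ * g p.2} ∩
      {p : E × E | φ (t + τ) (p.1 + τ • p.2) = φ t p.1 + τ * g p.2})
    ((isClosed_eq (by fun_prop) (by fun_prop)).inter (isClosed_eq (by fun_prop) (by fun_prop)))

theorem ae_fwdDirs_nonempty (ht : 0 < t) : ∀ᵐ x ∂μ, (fwdDirs g φ t x).Nonempty := by
  obtain ⟨C, hC⟩ := H.speed t ht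
  have key : ∀ R : ℕ, μ ({x | ¬(fwdDirs g φ t x).Nonempty} ∩ Metric.closedBall 0 (R : ℝ)) = 0 := by
    intro R
    set K := Metric.closedBall (0 : E) (R : ℝ)
    have hK : IsCompact K := isCompact_closedBall 0 (R : ℝ)
    have hlim : Filter.Tendsto (fun δ : ℝ => ((t + δ - δ) / (t + δ)) ^ Module.finrank ℝ E)
        (nhdsWithin 0 (Ioi 0)) (nhds 1) := by
      refine Filter.Tendsto.mono_left ?_ nhdsWithin_le_nhds
      have : ContinuousAt (fun δ : ℝ => ((t + δ - δ) / (t + δ)) ^ Module.finrank ℝ E) 0 := by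
        refine ContinuousAt.pow (ContinuousAt.div (by fun_prop) (by fun_prop) (by simp [ht.ne'])) _
      have h := this.tendsto
      simpa [ht.ne'] using h
    refine eq_zero_of_mul_add_le_cthickening (μ := μ) hK C hlim ?_
    filter_upwards [self_mem_nhdsWithin] with δ (hδ : 0 < δ)
    set X := {x | ∃ u ∈ Metric.closedBall (0 : E) C, FwdDir g φ t x δ u} with hX
    have hXm : MeasurableSet X := (H.isClosed_exists_fwdDir ht.le hδ.le 0 C).measurableSet
    rw [← measure_inter_add_sdiff (Metric.cthickening (C * δ) K) hXm]
    refine add_le_add ?_ (measure_mono ?_)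
    · refine H.mul_measure_le_back μ hδ (by linarith) le_rfl 0
        (fun x _ => H.exists_back _ (by linarith) x) fun x hx u hu _ => ?_
      have hn := hC _ (by linarith) x u hu
      constructor
      · refine Metric.mem_cthickening_of_dist_le _ x _ _ hx ?_
        rw [dist_eq_norm, sub_sub_cancel_left, norm_neg, norm_smul, Real.norm_of_nonneg hδ.le,
          mul_comm]
        gcongr
      · refine ⟨u, by simpa using hn, ?_⟩
        have := (H.back_mono hu hδ (by linarith) le_rfl).fwdDir
        rwa [add_sub_cancel_right] at this
    · rintro x ⟨hx, hxK⟩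
      refine ⟨Metric.self_subset_cthickening _ hxK, ?_⟩
      rintro ⟨u, -, hu⟩
      exact hx ⟨u, δ, hδ, hu⟩
  have hU : {x | ¬(fwdDirs g φ t x).Nonempty} ⊆
      ⋃ R : ℕ, {x | ¬(fwdDirs g φ t x).Nonempty} ∩ Metric.closedBall 0 (R : ℝ) := by
    intro x hx
    obtain ⟨R, hR⟩ := exists_nat_ge ‖x‖
    exact mem_iUnion.2 ⟨R, hx, by simpa using hR⟩
  exact measure_mono_null hU (measure_iUnion_null key)

end HopfLax
end AlmostEverywhere

section AlmostEverywhereGood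

variable {E : Type*} [NormedAddCommGroup E] [InnerProductSpace ℝ E] [FiniteDimensional ℝ E]
  [MeasurableSpace E] [BorelSpace E] (μ : Measure E) [μ.IsAddHaarMeasure]
  {g : E → ℝ} {φ : ℝ → E → ℝ} {t τ σ δ : ℝ}

namespace HopfLax

/-- Points with a backward velocity near `w₁` and a forward velocity near `w₂`, but without any
two-sided velocity near the mixture `a • w₂ + (1 - a) • w₁`. -/
def gapSet (g : E → ℝ) (φ : ℝ → E → ℝ) (t a ε τ : ℝ) (w₁ w₂ : E) : Set E :=
  {x | (∃ u ∈ Metric.closedBall w₁ ε, BackDir g φ t x τ u) ∧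
    (∃ u ∈ Metric.closedBall w₂ ε, FwdDir g φ t x τ u) ∧
    ∀ k : ℕ, t / (k + 1) ≤ t → ¬∃ u ∈ Metric.closedBall (a • w₂ + (1 - a) • w₁) ε,
      BackDir g φ t x (t / (k + 1)) u ∧ FwdDir g φ t x (t / (k + 1)) u}

variable (H : HopfLax g φ)
include H

lemma measurableSet_gapSet (ht : 0 < t) (hτ : 0 < τ) (hτt : τ ≤ t) (a ε : ℝ) (w₁ w₂ : E) :
    MeasurableSet (gapSet g φ t a ε τ w₁ w₂) := by
  have e : gapSet g φ t a ε τ w₁ w₂ = {x | ∃ u ∈ Metric.closedBall w₁ ε, BackDir g φ t x τ u} ∩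
      ({x | ∃ u ∈ Metric.closedBall w₂ ε, FwdDir g φ t x τ u} ∩
      ⋂ k : ℕ, ⋂ _ : t / (k + 1) ≤ t, {x | ∃ u ∈ Metric.closedBall (a • w₂ + (1 - a) • w₁) ε,
        BackDir g φ t x (t / (k + 1)) u ∧ FwdDir g φ t x (t / (k + 1)) u}ᶜ) := by
    ext x
    simp only [gapSet, mem_inter_iff, mem_iInter, mem_compl_iff, mem_ofPred_eq]
  rw [e]
  exact (H.isClosed_exists_backDir hτ.le hτt w₁ ε).measurableSet.inter
    ((H.isClosed_exists_fwdDir ht.le hτ.le w₂ ε).measurableSet.inter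
    (MeasurableSet.iInter fun k => MeasurableSet.iInter fun hk =>
      (H.isClosed_exists_backDir_fwdDir (by positivity) hk _ ε).measurableSet.compl))

omit [FiniteDimensional ℝ E] [MeasurableSpace E] [BorelSpace E] in
lemma notMem_gapSet (ht : 0 < t) {a ε : ℝ} {w₁ w₂ x u : E}
    (hu : u ∈ Metric.closedBall (a • w₂ + (1 - a) • w₁) ε)
    (hσ : 0 < σ) (hσt : σ ≤ t) (hb : BackDir g φ t x σ u) (hδ : 0 < δ) (hf : FwdDir g φ t x δ u) :
    x ∉ gapSet g φ t a ε τ w₁ w₂ := by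
  rintro ⟨-, -, h⟩
  obtain ⟨k, hk⟩ := exists_nat_gt (t / min σ δ)
  have hm : 0 < min σ δ := lt_min hσ hδ
  have hle : t / ((k : ℝ) + 1) ≤ min σ δ := by
    rw [div_lt_iff₀ hm] at hk
    rw [div_le_iff₀ (by positivity)]
    nlinarith
  have hpos : 0 < t / ((k : ℝ) + 1) := by positivity
  have h1 := hle.trans (min_le_left _ _)
  have h2 := hle.trans (min_le_right _ _)
  exact h k (h1.trans hσt) ⟨u, hu, H.back_mono hb hpos h1 hσt, H.fwd_mono hf hpos h2 ht.le⟩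

theorem measure_gapSet (ht : 0 < t) (hτ : 0 < τ) (hτt : τ ≤ t) {a ε : ℝ} (ha : 0 < a)
    (ha1 : a < 1) (w₁ w₂ : E) : μ (gapSet g φ t a ε τ w₁ w₂) = 0 := by
  rw [(H.measurableSet_gapSet ht hτ hτt a ε w₁ w₂).measure_eq_iSup_isCompact]
  simp only [ENNReal.iSup_eq_zero]
  intro K hKA hK
  set m := a • w₂ + (1 - a) • w₁ with hm
  set c := ENNReal.ofReal ((1 - a) ^ Module.finrank ℝ E) *
    ENNReal.ofReal ((1 / 2) ^ Module.finrank ℝ E) with hc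
  have hc0 : c ≠ 0 := by
    have : 0 < 1 - a := by linarith
    refine mul_ne_zero ?_ ?_ <;> rw [Ne, ENNReal.ofReal_eq_zero, not_le] <;> positivity
  suffices h : c * μ K = 0 from (mul_eq_zero.1 h).resolve_left hc0
  refine eq_zero_of_mul_add_le_cthickening (μ := μ) hK (‖w₂‖ + ε + (‖m‖ + ε)) (c := fun _ => 1)
    tendsto_const_nhds ?_
  have ha2 : 0 < 1 - a := by linarith
  filter_upwards [Ioo_mem_nhdsGT (show 0 < min (τ / 2) (τ * a / (1 - a)) by positivity)]
    with δ hδ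
  obtain ⟨hδ0, hδ1⟩ := hδ
  have hδ2 : 2 * δ ≤ τ := by have := hδ1.trans_le (min_le_left _ _); linarith
  have hδ3 : δ * (1 - a) ≤ τ * a :=
    ((le_div_iff₀ ha2).1 (hδ1.le.trans (min_le_right _ _)))
  set σ := δ * (1 - a) / a with hσdef
  have hσ0 : 0 < σ := by positivity
  have hστ : σ ≤ τ := by rw [hσdef, div_le_iff₀ ha]; exact hδ3
  have hsum : δ + σ = δ / a := by rw [hσdef]; field_simp; ring
  have hs0 : 0 < δ + σ := by positivity
  have hw1 : δ / (δ + σ) = a := by rw [hsum]; field_simp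
  have hw2 : σ / (δ + σ) = 1 - a := by rw [hsum, hσdef]; field_simp
  set B : Set E := {z | ∃ x ∈ K, ∃ u ∈ Metric.closedBall w₂ ε, FwdDir g φ t x δ u ∧
    z = x + δ • u} with hB
  have step1 : ENNReal.ofReal ((1 / 2) ^ Module.finrank ℝ E) * μ K ≤ μ B := by
    have := H.mul_measure_le_fwd μ (A := K) (B := B) ht.le hδ0 (by linarith : δ < 2 * δ) w₂ ?_ ?_
    · rwa [show (2 * δ - δ) / (2 * δ) = 1 / 2 by field_simp; ring] at this
    · intro x hx
      obtain ⟨-, ⟨u, -, hu⟩, -⟩ := hKA hx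
      exact ⟨u, H.fwd_mono hu (by linarith) hδ2 ht.le⟩
    · intro x hx u hu hnear
      obtain ⟨-, ⟨v, hv, hv'⟩, -⟩ := hKA hx
      refine ⟨x, hx, u, ?_, H.fwd_mono hu hδ0 (by linarith) ht.le, rfl⟩
      rw [mem_closedBall_iff_norm] at hv ⊢
      exact (hnear v (H.fwd_mono hv' (by linarith) hδ2 ht.le)).trans hv
  have hmix : ∀ x ∈ K, ∀ u ∈ Metric.closedBall w₂ ε, FwdDir g φ t x δ u →
      ∃ v ∈ Metric.closedBall m ε, BackDir g φ (t + δ) (x + δ • u) (δ + σ) v := by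
    intro x hx u hu hu'
    obtain ⟨⟨v, hv, hv'⟩, -, -⟩ := hKA hx
    refine ⟨_, ?_, (H.concat hu' (H.back_mono hv' hσ0 hστ hτt) hδ0 hσ0 (hστ.trans hτt)).1⟩
    rw [hw1, hw2]
    rw [mem_closedBall_iff_norm] at *
    have e : a • u + (1 - a) • v - m = a • (u - w₂) + (1 - a) • (v - w₁) := by rw [hm]; module
    rw [e]
    refine (norm_add_le _ _).trans ?_
    rw [norm_smul, norm_smul, Real.norm_of_nonneg ha.le, Real.norm_of_nonneg ha2.le]
    nlinarith
  have step2 : ENNReal.ofReal ((1 - a) ^ Module.finrank ℝ E) * μ B ≤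
      μ (Metric.cthickening ((‖w₂‖ + ε + (‖m‖ + ε)) * δ) K \ K) := by
    rw [← hw2, show σ = δ + σ - δ by ring, show δ + (δ + σ - δ) = δ + σ by ring]
    refine H.mul_measure_le_back μ (t := t + δ) hδ0 (by linarith) (by linarith) m ?_ ?_
    · rintro z ⟨x, hx, u, hu, hu', rfl⟩
      obtain ⟨v, -, hv⟩ := hmix x hx u hu hu'
      exact ⟨v, hv⟩
    · rintro z ⟨x, hx, u, hu, hu', rfl⟩ v hv hnear
      obtain ⟨v', hv', hv''⟩ := hmix x hx u hu hu'
      have hvm : v ∈ Metric.closedBall m ε := by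
        rw [mem_closedBall_iff_norm] at hv' ⊢
        exact (hnear v' hv'').trans hv'
      constructor
      · refine Metric.mem_cthickening_of_dist_le _ x _ _ hx ?_
        have e : x + δ • u - δ • v - x = δ • (u - v) := by module
        rw [dist_eq_norm, e, norm_smul, Real.norm_of_nonneg hδ0.le, mul_comm]
        gcongr
        refine (norm_sub_le _ _).trans (add_le_add ?_ ?_)
        · exact norm_le_norm_add_const_of_dist_le hu
        · exact norm_le_norm_add_const_of_dist_le hvm
      · intro hK'
        have h1 := (H.back_mono hv hδ0 (by linarith) (by linarith)).fwdDir
        have h2 := H.back_step hv hδ0 (by linarith) (by linarith)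
        rw [add_sub_cancel_right] at h1 h2
        rw [add_sub_cancel_left] at h2
        exact H.notMem_gapSet ht hvm hσ0 (hστ.trans hτt) h2 hδ0 h1 (hKA hK')
  rw [ENNReal.ofReal_one, one_mul, ← measure_inter_add_sdiff (Metric.cthickening _ K)
    hK.measurableSet]
  refine add_le_add (measure_mono fun x hx => ⟨Metric.self_subset_cthickening _ hx, hx⟩) ?_
  rw [hc, mul_assoc]
  exact (mul_le_mul_right step1 _).trans step2

theorem ae_mix_mem_closure (ht : 0 < t) : ∀ᵐ x ∂μ, ∀ v ∈ backDirs g φ t x,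
    ∀ w ∈ fwdDirs g φ t x, ∀ a b : ℝ, 0 < a → 0 < b → a + b = 1 →
      a • w + b • v ∈ closure (backDirs g φ t x ∩ fwdDirs g φ t x) := by
  set D := TopologicalSpace.denseSeq E
  have h1 : ∀ᵐ x ∂μ, ∀ (q : ℚ) (i j n k : ℕ), 0 < (q : ℝ) → (q : ℝ) < 1 →
      x ∉ gapSet g φ t q (1 / ((n : ℝ) + 1)) (t / ((k : ℝ) + 1)) (D i) (D j) := by
    simp only [ae_all_iff]
    intro q i j n k hq0 hq1
    exact measure_eq_zero_iff_ae_notMem.1 (H.measure_gapSet μ ht (by positivity)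
      (div_le_self ht.le (by linarith [(k.cast_nonneg : (0 : ℝ) ≤ k)])) hq0 hq1 _ _)
  filter_upwards [h1] with x hx v hv w hw
  have key : ∀ q : ℚ, 0 < (q : ℝ) → (q : ℝ) < 1 →
      (q : ℝ) • w + (1 - (q : ℝ)) • v ∈ closure (backDirs g φ t x ∩ fwdDirs g φ t x) := by
    intro q hq0 hq1
    rw [Metric.mem_closure_iff]
    intro r hr
    obtain ⟨n, hn⟩ := exists_nat_one_div_lt (half_pos hr)
    set ε := 1 / ((n : ℝ) + 1) with hε
    have hε0 : 0 < ε := Nat.one_div_pos_of_nat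
    obtain ⟨i, hi⟩ := (TopologicalSpace.denseRange_denseSeq E).exists_dist_lt v hε0
    obtain ⟨j, hj⟩ := (TopologicalSpace.denseRange_denseSeq E).exists_dist_lt w hε0
    obtain ⟨τ₁, hτ₁, hτ₁t, hv'⟩ := hv
    obtain ⟨τ₂, hτ₂, hw'⟩ := hw
    obtain ⟨k, hk⟩ := exists_nat_gt (t / min τ₁ τ₂)
    have hm : 0 < min τ₁ τ₂ := lt_min hτ₁ hτ₂
    have hle : t / ((k : ℝ) + 1) ≤ min τ₁ τ₂ := by
      rw [div_lt_iff₀ hm] at hk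
      rw [div_le_iff₀ (by positivity)]
      nlinarith
    have hpos : 0 < t / ((k : ℝ) + 1) := by positivity
    have hx' := hx q i j n k hq0 hq1
    by_contra! hcon
    refine hx' ⟨⟨v, hi.le, H.back_mono hv' hpos (hle.trans (min_le_left _ _)) hτ₁t⟩,
      ⟨w, hj.le, H.fwd_mono hw' hpos (hle.trans (min_le_right _ _)) ht.le⟩, ?_⟩
    rintro l hl ⟨u, hu, hub, huf⟩
    have hl0 : 0 < t / ((l : ℝ) + 1) := by positivity
    have := hcon u ⟨⟨_, hl0, hl, hub⟩, ⟨_, hl0, huf⟩⟩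
    rw [dist_eq_norm] at this hi hj
    rw [mem_closedBall_iff_norm] at hu
    have e : (q : ℝ) • w + (1 - (q : ℝ)) • v - u = (q : ℝ) • (w - D j) + (1 - (q : ℝ)) • (v - D i)
      - (u - ((q : ℝ) • D j + (1 - (q : ℝ)) • D i)) := by module
    have hle2 : ‖(q : ℝ) • w + (1 - (q : ℝ)) • v - u‖ ≤
        q * ‖w - D j‖ + (1 - q) * ‖v - D i‖ + ε := by
      rw [e]
      refine (norm_sub_le _ _).trans (add_le_add ((norm_add_le _ _).trans ?_) hu)
      rw [norm_smul, norm_smul, Real.norm_of_nonneg hq0.le, Real.norm_of_nonneg (by linarith)]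
    nlinarith
  intro a b ha hb hab
  obtain rfl : b = 1 - a := by linarith
  have hcl : IsClosed {s : ℝ | s • w + (1 - s) • v ∈
      closure (backDirs g φ t x ∩ fwdDirs g φ t x)} := isClosed_closure.preimage (by fun_prop)
  have hd : a ∈ closure (Ioo 0 1 ∩ range ((↑) : ℚ → ℝ)) :=
    Rat.denseRange_cast.open_subset_closure_inter isOpen_Ioo ⟨ha, by linarith⟩
  refine hcl.closure_subset_iff.2 ?_ hd
  rintro _ ⟨⟨h0, h1⟩, q, rfl⟩
  exact key q h0 h1

theorem ae_goodPoint (ht : 0 < t) : ∀ᵐ x ∂μ, GoodPoint g φ t x := by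
  filter_upwards [H.ae_fwdDirs_nonempty μ ht, H.ae_mix_mem_closure μ ht] with x hf hL
  obtain ⟨u, hu⟩ := H.exists_back t ht x
  exact H.goodPoint_of_mix_mem_closure ht.le ⟨u, t, ht, le_rfl, hu⟩ hf hL

lemma ae_exists_near_back (hσ : 0 < σ) (hστ : σ < τ) (hτt : τ ≤ t) (w₀ : E) :
    ∀ᵐ x ∂μ, ∃ u, BackDir g φ t x τ u ∧ (∀ u', BackDir g φ t x τ u' → ‖u - w₀‖ ≤ ‖u' - w₀‖) ∧
      GoodPoint g φ (t - σ) (x - σ • u) := by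
  have h := H.mul_measure_le_back μ hσ hστ hτt w₀
    (A := {x | ¬∃ u, BackDir g φ t x τ u ∧ (∀ u', BackDir g φ t x τ u' → ‖u - w₀‖ ≤ ‖u' - w₀‖) ∧
      GoodPoint g φ (t - σ) (x - σ • u)}) (B := {x | ¬GoodPoint g φ (t - σ) x}) ?_ ?_
  · rw [ae_iff.1 (H.ae_goodPoint μ (t := t - σ) (by linarith)), nonpos_iff_eq_zero] at h
    refine ae_iff.2 ((mul_eq_zero.1 h).resolve_left ?_)
    rw [ENNReal.ofReal_eq_zero, not_le]
    have : 0 < τ - σ := by linarith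
    have : 0 < τ := by linarith
    positivity
  · intro x _
    obtain ⟨u, hu⟩ := H.exists_back t (by linarith) x
    exact ⟨u, H.back_mono hu (by linarith) hτt le_rfl⟩
  · intro x hx u hu hnear hgood
    exact hx ⟨u, hu, hnear, hgood⟩

lemma ae_exists_near_fwd (ht : 0 < t) (hσ : 0 < σ) (hστ : σ < τ) (w₀ : E) :
    ∀ᵐ x ∂μ, (∃ u, FwdDir g φ t x τ u) →
      ∃ u, FwdDir g φ t x τ u ∧ (∀ u', FwdDir g φ t x τ u' → ‖u - w₀‖ ≤ ‖u' - w₀‖) ∧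
      GoodPoint g φ (t + σ) (x + σ • u) := by
  have h := H.mul_measure_le_fwd μ ht.le hσ hστ w₀
    (A := {x | ¬((∃ u, FwdDir g φ t x τ u) →
      ∃ u, FwdDir g φ t x τ u ∧ (∀ u', FwdDir g φ t x τ u' → ‖u - w₀‖ ≤ ‖u' - w₀‖) ∧
      GoodPoint g φ (t + σ) (x + σ • u))}) (B := {x | ¬GoodPoint g φ (t + σ) x}) ?_ ?_
  · rw [ae_iff.1 (H.ae_goodPoint μ (t := t + σ) (by linarith)), nonpos_iff_eq_zero] at h
    refine ae_iff.2 ((mul_eq_zero.1 h).resolve_left ?_)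
    rw [ENNReal.ofReal_eq_zero, not_le]
    have : 0 < τ - σ := by linarith
    have : 0 < τ := by linarith
    positivity
  · intro x hx
    by_contra hne
    exact hx fun h => absurd h hne
  · intro x hx u hu hnear hgood
    exact hx fun _ => ⟨u, hu, hnear, hgood⟩

/-- Almost every point has a nonempty convex set `K` of backward velocities which equals its set
of forward velocities, and is joined by rays with velocities in the relative interior of `K` to
an earlier and a later point with the same velocity sets. -/
theorem ae_exists_relint_ray (ht : 0 < t) : ∀ᵐ x ∂μ, GoodPoint g φ t x ∧
    (∃ w ∈ intrinsicInterior ℝ (backDirs g φ t x), ∃ δ, 0 < δ ∧ δ < t ∧ BackDir g φ t x δ w ∧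
      GoodPoint g φ (t - δ) (x - δ • w) ∧ backDirs g φ (t - δ) (x - δ • w) = backDirs g φ t x) ∧
    (∃ w ∈ intrinsicInterior ℝ (backDirs g φ t x), ∃ δ, 0 < δ ∧ FwdDir g φ t x δ w ∧
      GoodPoint g φ (t + δ) (x + δ • w) ∧
      backDirs g φ (t + δ) (x + δ • w) = backDirs g φ t x) := by
  set D := TopologicalSpace.denseSeq E
  have hk0 : ∀ k : ℕ, 0 < t / ((k : ℝ) + 1) := fun k => by positivity
  have hk1 : ∀ k : ℕ, t / ((k : ℝ) + 1) ≤ t := fun k =>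
    div_le_self ht.le (by linarith [(k.cast_nonneg : (0 : ℝ) ≤ k)])
  have hb : ∀ᵐ x ∂μ, ∀ k i : ℕ, ∃ u, BackDir g φ t x (t / ((k : ℝ) + 1)) u ∧
      (∀ u', BackDir g φ t x (t / ((k : ℝ) + 1)) u' → ‖u - D i‖ ≤ ‖u' - D i‖) ∧
      GoodPoint g φ (t - t / ((k : ℝ) + 1) / 2) (x - (t / ((k : ℝ) + 1) / 2) • u) := by
    simp only [ae_all_iff]
    exact fun k i => H.ae_exists_near_back μ (half_pos (hk0 k)) (half_lt_self (hk0 k)) (hk1 k) _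
  have hf : ∀ᵐ x ∂μ, ∀ k i : ℕ, (∃ u, FwdDir g φ t x (t / ((k : ℝ) + 1)) u) →
      ∃ u, FwdDir g φ t x (t / ((k : ℝ) + 1)) u ∧
      (∀ u', FwdDir g φ t x (t / ((k : ℝ) + 1)) u' → ‖u - D i‖ ≤ ‖u' - D i‖) ∧
      GoodPoint g φ (t + t / ((k : ℝ) + 1) / 2) (x + (t / ((k : ℝ) + 1) / 2) • u) := by
    simp only [ae_all_iff]
    exact fun k i => H.ae_exists_near_fwd μ ht (half_pos (hk0 k)) (half_lt_self (hk0 k)) _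
  filter_upwards [H.ae_goodPoint μ ht, hb, hf] with x hgood hxb hxf
  refine ⟨hgood, ?_⟩
  obtain ⟨v, hv⟩ := Set.Nonempty.intrinsicInterior hgood.2.2 hgood.2.1
  obtain ⟨r, hr, hball⟩ := exists_ball_inter_subset_intrinsicInterior hv
  obtain ⟨i, hi⟩ := (TopologicalSpace.denseRange_denseSeq E).exists_dist_lt v (half_pos hr)
  obtain ⟨τ₁, hτ₁, hτ₁t, hvb⟩ := intrinsicInterior_subset hv
  obtain ⟨τ₂, hτ₂, hvf⟩ := hgood.1 ▸ intrinsicInterior_subset hv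
  obtain ⟨k, hk⟩ := exists_nat_gt (t / min τ₁ τ₂)
  have hm : 0 < min τ₁ τ₂ := lt_min hτ₁ hτ₂
  have hle : t / ((k : ℝ) + 1) ≤ min τ₁ τ₂ := by
    rw [div_lt_iff₀ hm] at hk
    rw [div_le_iff₀ (by positivity)]
    nlinarith
  set s := t / ((k : ℝ) + 1) with hs
  have hs0 : 0 < s := hk0 k
  have hst : s ≤ t := hk1 k
  have hvb' := H.back_mono hvb hs0 (hle.trans (min_le_left _ _)) hτ₁t
  have hvf' := H.fwd_mono hvf hs0 (hle.trans (min_le_right _ _)) ht.le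
  have hnear : ∀ u, ‖u - D i‖ ≤ ‖v - D i‖ → dist u v < r := by
    intro u hu
    have := dist_triangle_right u v (D i)
    rw [dist_eq_norm] at hi
    rw [dist_eq_norm u (D i), dist_eq_norm v (D i)] at this
    linarith
  constructor
  · obtain ⟨u, hu, hn, hg⟩ := hxb k i
    have hub := H.back_mono hu (half_pos hs0) (half_le_self hs0.le) hst
    refine ⟨u, hball u ⟨s, hs0, hst, hu⟩ (hnear u (hn v hvb')), s / 2, half_pos hs0,
      by linarith, hub, hg, ?_⟩
    have := H.backDirs_eq_of_ray (t := t - s / 2) (by linarith) (half_pos hs0) hub.fwdDir hg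
      (by rwa [sub_add_cancel, sub_add_cancel])
    rw [sub_add_cancel, sub_add_cancel] at this
    exact this.symm
  · obtain ⟨u, hu, hn, hg⟩ := hxf k i ⟨v, hvf'⟩
    have huf := H.fwd_mono hu (half_pos hs0) (half_le_self hs0.le) ht.le
    have huK : u ∈ backDirs g φ t x := by rw [hgood.1]; exact ⟨s, hs0, hu⟩
    exact ⟨u, hball u huK (hnear u (hn v hvf')), s / 2, half_pos hs0, huf, hg,
      H.backDirs_eq_of_ray ht (half_pos hs0) huf hgood hg⟩

end HopfLax

end AlmostEverywhereGood

section Concrete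

variable {d : ℕ} {c : EuclideanSpace ℝ (Fin d) → ℝ} {φ : Spt d → ℝ}

lemma cbar_smul {τ : ℝ} (hτ : 0 < τ) (u : EuclideanSpace ℝ (Fin d)) :
    cbar c (τ, τ • u) = ENNReal.ofReal (τ * c (-u)) := by
  simp [cbar, hτ, inv_smul_smul₀ hτ.ne']

lemma coe_eq_coe_ofReal_iff {a b : ℝ} (hb : 0 ≤ b) :
    ((a : ℝ) : EReal) = ((ENNReal.ofReal b : ENNReal) : EReal) ↔ a = b := by
  rw [EReal.coe_ennreal_ofReal, max_eq_left hb, EReal.coe_eq_coe_iff]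

lemma eq_smul_of_cbar_ne_top {z : Spt d} (hz : cbar c z ≠ ⊤) (h0 : z ≠ 0) :
    0 < z.1 ∧ z = (z.1, z.1 • z.1⁻¹ • z.2) := by
  unfold cbar at hz
  split_ifs at hz with h1 h2
  · exact ⟨h1, by rw [smul_inv_smul₀ h1.ne']⟩
  · exact absurd (Prod.ext h2.1 h2.2) h0
  · exact absurd rfl hz

section Directions

variable (hc : ∀ x, 0 ≤ c x)
include hc

lemma mem_sdMinus_iff {t τ : ℝ} (hτ : 0 < τ) (hτt : τ ≤ t) {x u : EuclideanSpace ℝ (Fin d)} :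
    (t - τ, x - τ • u) ∈ sdMinus c φ (t, x) ↔
      BackDir (fun w => c (-w)) (fun s y => φ (s, y)) t x τ u := by
  have e : ((t, x) : Spt d) - (t - τ, x - τ • u) = (τ, τ • u) := by simp
  simp only [sdMinus, mem_ofPred_eq, e, cbar_smul hτ,
    coe_eq_coe_ofReal_iff (mul_nonneg hτ.le (hc _)), BackDir, sub_eq_iff_eq_add']
  refine ⟨fun h => h.2.2, fun h => ⟨sub_nonneg.2 hτt, ENNReal.ofReal_ne_top, h⟩⟩

lemma mem_sdPlus_iff {t τ : ℝ} (ht : 0 ≤ t) (hτ : 0 < τ) {x u : EuclideanSpace ℝ (Fin d)} :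
    (t + τ, x + τ • u) ∈ sdPlus c φ (t, x) ↔
      FwdDir (fun w => c (-w)) (fun s y => φ (s, y)) t x τ u := by
  have e : ((t + τ, x + τ • u) : Spt d) - (t, x) = (τ, τ • u) := by simp
  simp only [sdPlus, mem_ofPred_eq, e, cbar_smul hτ,
    coe_eq_coe_ofReal_iff (mul_nonneg hτ.le (hc _)), FwdDir, sub_eq_iff_eq_add']
  refine ⟨fun h => h.2.2, fun h => ⟨?_, ENNReal.ofReal_ne_top, h⟩⟩
  exact add_nonneg ht hτ.le

lemma dirMinus_eq (t : ℝ) (x : EuclideanSpace ℝ (Fin d)) :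
    DirMinus c φ (t, x) =
      (fun u => ((1 : ℝ), u)) '' backDirs (fun w => c (-w)) (fun s y => φ (s, y)) t x := by
  ext v
  constructor
  · rintro ⟨⟨t', x'⟩, hz, hne, rfl⟩
    obtain ⟨h1, h2⟩ := eq_smul_of_cbar_ne_top hz.2.1 (sub_ne_zero.2 hne.symm)
    simp only [Prod.mk_sub_mk] at h1 h2
    refine ⟨(t - t')⁻¹ • (x - x'), ⟨t - t', h1, ?_, (mem_sdMinus_iff hc h1 ?_).1 ?_⟩, ?_⟩
    · have : 0 ≤ t' := hz.1
      linarith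
    · have : 0 ≤ t' := hz.1
      linarith
    · rw [smul_inv_smul₀ h1.ne', sub_sub_cancel, sub_sub_cancel]
      exact hz
    · simp [h1.ne']
  · rintro ⟨u, ⟨τ, hτ, hτt, hu⟩, rfl⟩
    refine ⟨_, (mem_sdMinus_iff hc hτ hτt).2 hu, ?_, ?_⟩
    · intro h
      have := congrArg Prod.fst h
      simp at this
      exact hτ.ne' this
    · simp [hτ.ne']

lemma dirPlus_eq {t : ℝ} (ht : 0 ≤ t) (x : EuclideanSpace ℝ (Fin d)) :
    DirPlus c φ (t, x) =
      (fun u => ((1 : ℝ), u)) '' fwdDirs (fun w => c (-w)) (fun s y => φ (s, y)) t x := by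
  ext v
  constructor
  · rintro ⟨⟨t', x'⟩, hz, hne, rfl⟩
    obtain ⟨h1, h2⟩ := eq_smul_of_cbar_ne_top hz.2.1 (sub_ne_zero.2 hne)
    simp only [Prod.mk_sub_mk] at h1 h2
    refine ⟨(t' - t)⁻¹ • (x' - x), ⟨t' - t, h1, (mem_sdPlus_iff hc ht h1).1 ?_⟩, ?_⟩
    · rw [smul_inv_smul₀ h1.ne', add_sub_cancel, add_sub_cancel]
      exact hz
    · simp [h1.ne']
  · rintro ⟨u, ⟨τ, hτ, hu⟩, rfl⟩
    refine ⟨_, (mem_sdPlus_iff hc ht hτ).2 hu, ?_, ?_⟩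
    · intro h
      have := congrArg Prod.fst h
      simp at this
      exact hτ.ne' this
    · simp [hτ.ne']

end Directions

lemma mem_Tminus_of_nonempty {z : Spt d} (h : (DirMinus c φ z).Nonempty) : z ∈ Tminus c φ := by
  obtain ⟨_, z', hz', hne, -⟩ := h
  intro h
  rw [h] at hz'
  exact hne hz'

lemma mem_Tplus_of_nonempty {z : Spt d} (h : (DirPlus c φ z).Nonempty) : z ∈ Tplus c φ := by
  obtain ⟨_, z', hz', hne, -⟩ := h
  intro h
  rw [h] at hz'
  exact hne hz'

lemma convex_image_one_prod {E : Type*} [AddCommGroup E] [Module ℝ E] {K : Set E}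
    (hK : Convex ℝ K) : Convex ℝ ((fun u => ((1 : ℝ), u)) '' K) := by
  rintro _ ⟨u, hu, rfl⟩ _ ⟨v, hv, rfl⟩ a b ha hb hab
  exact ⟨a • u + b • v, hK hu hv ha hb hab, by simp [hab]⟩

lemma adim_image_one_prod_le (K : Set (EuclideanSpace ℝ (Fin d))) :
    adim ((fun u => ((1 : ℝ), u)) '' K) ≤ d := by
  have h : (affineSpan ℝ ((fun u => ((1 : ℝ), u)) '' K)).direction ≤
      LinearMap.range (LinearMap.inr ℝ ℝ (EuclideanSpace ℝ (Fin d))) := by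
    rw [direction_affineSpan, vectorSpan_def, Submodule.span_le]
    rintro _ ⟨_, ⟨u, hu, rfl⟩, _, ⟨v, hv, rfl⟩, rfl⟩
    exact ⟨u - v, by simp⟩
  refine (Submodule.finrank_mono h).trans ((LinearMap.finrank_range_le _).trans ?_)
  simp

lemma smul_mem_intrinsicInterior_cone {E : Type*} [NormedAddCommGroup E] [NormedSpace ℝ E]
    {K : Set E} (hK : Convex ℝ K) {w : E} (hw : w ∈ intrinsicInterior ℝ K) {δ : ℝ} (hδ : 0 < δ) :
    ((δ, δ • w) : ℝ × E) ∈ intrinsicInterior ℝ {v : ℝ × E | ∃ r : ℝ, 0 ≤ r ∧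
      ∃ p ∈ convexHull ℝ ((fun u => ((1 : ℝ), u)) '' K), v = r • p} := by
  rw [(convex_image_one_prod hK).convexHull_eq]
  set S := {v : ℝ × E | ∃ r : ℝ, 0 ≤ r ∧ ∃ p ∈ (fun u => ((1 : ℝ), u)) '' K, v = r • p}
  have hS : ∀ r : ℝ, 0 ≤ r → ∀ u ∈ K, ((r, r • u) : ℝ × E) ∈ S := fun r hr u hu =>
    ⟨r, hr, (1, u), mem_image_of_mem _ hu, by simp⟩
  obtain ⟨hwa, hwK⟩ := mem_intrinsicInterior_iff_nhdsWithin.1 hw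
  rw [mem_intrinsicInterior_iff_nhdsWithin]
  refine ⟨subset_affineSpan ℝ S (hS δ hδ.le w (intrinsicInterior_subset hw)), ?_⟩
  let N : Submodule ℝ (ℝ × E) := (affineSpan ℝ K).direction.comap
    (LinearMap.snd ℝ ℝ E - (LinearMap.fst ℝ ℝ E).smulRight w)
  have hN : ∀ p : ℝ × E, p ∈ N ↔ p.2 - p.1 • w ∈ (affineSpan ℝ K).direction := by
    intro p; rfl
  have hSN : affineSpan ℝ S ≤ N.toAffineSubspace := by
    rw [affineSpan_le]
    rintro _ ⟨r, hr, _, ⟨u, hu, rfl⟩, rfl⟩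
    refine (hN _).2 ?_
    have := (affineSpan ℝ K).direction.smul_mem r
      (AffineSubspace.vsub_mem_direction (subset_affineSpan ℝ K hu) hwa)
    simpa [smul_sub] using this
  have hcont : Filter.Tendsto (fun p : ℝ × E => p.1⁻¹ • p.2)
      (nhds (δ, δ • w)) (nhds w) := by
    have : ContinuousAt (fun p : ℝ × E => p.1⁻¹ • p.2) (δ, δ • w) :=
      (continuousAt_fst.inv₀ hδ.ne').smul continuousAt_snd
    have h := this.tendsto
    simpa [inv_smul_smul₀ hδ.ne'] using h
  have hpos : ∀ᶠ p in nhds ((δ, δ • w) : ℝ × E), 0 < p.1 :=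
    continuousAt_fst.eventually_const_lt hδ
  obtain ⟨O, hO, hOw, hOK⟩ := mem_nhdsWithin.1 hwK
  filter_upwards [nhdsWithin_le_nhds (hcont (hO.mem_nhds hOw)), nhdsWithin_le_nhds hpos,
    self_mem_nhdsWithin] with p hp1 hp2 hp3
  have hp4 : p.1⁻¹ • p.2 ∈ affineSpan ℝ K := by
    have h1 := (affineSpan ℝ K).direction.smul_mem p.1⁻¹ ((hN p).1 (hSN hp3))
    rw [smul_sub, inv_smul_smul₀ hp2.ne'] at h1
    have := AffineSubspace.vadd_mem_of_mem_direction h1 hwa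
    rwa [vadd_eq_add, sub_add_cancel] at this
  have := hS p.1 hp2.le _ (hOK ⟨hp1, hp4⟩)
  rwa [smul_inv_smul₀ hp2.ne'] at this

lemma mem_Rreg_of_relint_rays (hc : ∀ x, 0 ≤ c x) {g : EuclideanSpace ℝ (Fin d) → ℝ}
    (hg : g = fun w => c (-w)) {Φ : ℝ → EuclideanSpace ℝ (Fin d) → ℝ}
    (hΦ : Φ = fun s y => φ (s, y)) {t : ℝ} (ht : 0 < t) {x : EuclideanSpace ℝ (Fin d)}
    (hgood : GoodPoint g Φ t x)
    (hback : ∃ w ∈ intrinsicInterior ℝ (backDirs g Φ t x), ∃ δ, 0 < δ ∧ δ < t ∧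
      BackDir g Φ t x δ w ∧ GoodPoint g Φ (t - δ) (x - δ • w) ∧
      backDirs g Φ (t - δ) (x - δ • w) = backDirs g Φ t x)
    (hfwd : ∃ w ∈ intrinsicInterior ℝ (backDirs g Φ t x), ∃ δ, 0 < δ ∧ FwdDir g Φ t x δ w ∧
      GoodPoint g Φ (t + δ) (x + δ • w) ∧
      backDirs g Φ (t + δ) (x + δ • w) = backDirs g Φ t x) : ((t, x) : Spt d) ∈ Rreg c φ := by
  obtain ⟨h1, h2, h3⟩ := hgood
  set S := (fun u => ((1 : ℝ), u)) '' backDirs g Φ t x with hS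
  have hSne : S.Nonempty := h2.image _
  have hSc : Convex ℝ S := convex_image_one_prod h3
  have hm : DirMinus c φ (t, x) = S := by rw [dirMinus_eq hc, hS, hg, hΦ]
  have hp : DirPlus c φ (t, x) = S := by rw [dirPlus_eq hc ht.le, hS, h1, hg, hΦ]
  have hlt : adim S < d + 1 := Nat.lt_succ_of_le (adim_image_one_prod_le _)
  refine ⟨mem_iUnion₂.2 ⟨adim S, Finset.mem_range.2 hlt, ?_⟩,
    mem_iUnion₂.2 ⟨adim S, Finset.mem_range.2 hlt, ?_⟩⟩
  · obtain ⟨w, hw, δ, hδ, hray, hgood', hK⟩ := hfwd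
    have hm' : DirMinus c φ (t + δ, x + δ • w) = S := by
      rw [hS, ← hK, dirMinus_eq hc, hg, hΦ]
    refine ⟨mem_Tminus_of_nonempty (hm ▸ hSne), hm ▸ hSc, by rw [hm], (t + δ, x + δ • w),
      mem_Tminus_of_nonempty (hm' ▸ hSne), ?_, ?_, hm' ▸ hSc, by rw [hm']⟩
    · have := smul_mem_intrinsicInterior_cone h3 hw hδ
      rw [Fminus, hm]
      simpa using this
    · subst hg hΦ
      have := (mem_sdMinus_iff hc hδ (by linarith)).2 hray.backDir
      rwa [add_sub_cancel_right, add_sub_cancel_right] at this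
  · obtain ⟨w, hw, δ, hδ, hδt, hray, hgood', hK⟩ := hback
    have hp' : DirPlus c φ (t - δ, x - δ • w) = S := by
      rw [hS, ← hK, hgood'.1, dirPlus_eq hc (by linarith), hg, hΦ]
    refine ⟨mem_Tplus_of_nonempty (hp ▸ hSne), hp ▸ hSc, by rw [hp], (t - δ, x - δ • w),
      mem_Tplus_of_nonempty (hp' ▸ hSne), ?_, ?_, hp' ▸ hSc, by rw [hp']⟩
    · have := smul_mem_intrinsicInterior_cone h3 hw hδ
      rw [Fplus, hp]
      simpa using this
    · subst hg hΦ
      have := (mem_sdPlus_iff hc (by linarith) hδ).2 hray.fwdDir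
      rwa [sub_add_cancel, sub_add_cancel] at this

lemma hausdorffMeasure_slice_eq_zero {N : Set (EuclideanSpace ℝ (Fin d))} (hN : volume N = 0)
    (t : ℝ) : μH[(d : ℝ)] ((fun x => ((t, x) : Spt d)) '' N) = 0 := by
  have h1 : volume (WithLp.toLp 2 ⁻¹' N : Set (Fin d → ℝ)) = 0 :=
    (PiLp.volume_preserving_toLp (Fin d)).quasiMeasurePreserving.preimage_null hN
  have h2 : LipschitzWith _ (fun v : Fin d → ℝ => ((t, WithLp.toLp 2 v) : Spt d)) :=
    (LipschitzWith.const t).prodMk (PiLp.lipschitzWith_toLp 2 _)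
  have h3 := h2.hausdorffMeasure_image_le (d := d) (by positivity) (WithLp.toLp 2 ⁻¹' N)
  have h4 : (μH[(d : ℝ)] : Measure (Fin d → ℝ)) = volume := by
    have := hausdorffMeasure_pi_real (ι := Fin d)
    rwa [Fintype.card_fin] at this
  rw [h4, h1, mul_zero, nonpos_iff_eq_zero] at h3
  refine measure_mono_null ?_ h3
  rintro _ ⟨x, hx, rfl⟩
  exact ⟨WithLp.ofLp x, by simpa using hx, by simp⟩

end Concrete

section HopfLaxFormula

variable {d : ℕ} {c : EuclideanSpace ℝ (Fin d) → ℝ} {φ : Spt d → ℝ}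

lemma exists_norm_le_add (hnonneg : ∀ x, 0 ≤ c x)
    (hsuper : Filter.Tendsto (fun x => c x / ‖x‖)
      (Bornology.cobounded (EuclideanSpace ℝ (Fin d))) Filter.atTop) :
    ∃ B, 0 ≤ B ∧ ∀ x, ‖x‖ ≤ c x + B := by
  have h := hsuper.eventually_ge_atTop 1
  obtain ⟨R, -, hR⟩ := (Filter.HasBasis.eventually_iff
    (Metric.hasBasis_cobounded_compl_closedBall (0 : EuclideanSpace ℝ (Fin d)))).1 h
  refine ⟨max R 0, le_max_right _ _, fun x => ?_⟩
  by_cases hx : ‖x‖ ≤ max R 0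
  · linarith [hnonneg x]
  · rw [not_le, max_lt_iff] at hx
    have h1 : 1 ≤ c x / ‖x‖ := hR (by simpa using hx.1)
    rw [le_div_iff₀ hx.2] at h1
    linarith [le_max_right R 0]

variable {ψ : EuclideanSpace ℝ (Fin d) → ℝ}

lemma potential_term (hnonneg : ∀ x, 0 ≤ c x) {t : ℝ} (ht : 0 < t)
    (x y : EuclideanSpace ℝ (Fin d)) :
    (((-ψ y : ℝ)) : EReal) + (cbar c ((t, x) - ((0 : ℝ), y)) : EReal) =
      ((-ψ y + t * c (-(t⁻¹ • (x - y))) : ℝ) : EReal) := by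
  have e : ((t, x) : Spt d) - (0, y) = (t, t • t⁻¹ • (x - y)) := by
    simp [smul_inv_smul₀ ht.ne']
  rw [e, cbar_smul ht, EReal.coe_ennreal_ofReal, max_eq_left (mul_nonneg ht.le (hnonneg _)),
    EReal.coe_add]

section

variable (hφ : ∀ z ∈ Dom d, ((φ z : ℝ) : EReal) =
      ⨅ y : EuclideanSpace ℝ (Fin d),
        (((-ψ y : ℝ)) : EReal) + (cbar c (z - ((0 : ℝ), y)) : EReal))
include hφ

lemma potential_zero (x : EuclideanSpace ℝ (Fin d)) : φ (0, x) = -ψ x := by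
  rw [← EReal.coe_eq_coe_iff, hφ _ (show (0 : ℝ) ≤ 0 from le_rfl)]
  apply le_antisymm
  · refine (iInf_le _ x).trans ?_
    simp [cbar]
  · refine le_iInf fun y => ?_
    by_cases hxy : x - y = 0
    · obtain rfl := sub_eq_zero.1 hxy
      simp [cbar]
    · simp [cbar, hxy]

lemma potential_le (hnonneg : ∀ x, 0 ≤ c x) {t : ℝ} (ht : 0 < t)
    (x y : EuclideanSpace ℝ (Fin d)) : φ (t, x) ≤ -ψ y + t * c (-(t⁻¹ • (x - y))) := by
  rw [← EReal.coe_le_coe_iff, hφ _ (show (0 : ℝ) ≤ t from ht.le),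
    ← potential_term hnonneg ht]
  exact iInf_le _ y

lemma exists_potential_eq (hnonneg : ∀ x, 0 ≤ c x) (hc : Continuous c) {M B : ℝ}
    (hψbdd : ∀ y, |ψ y| ≤ M) (hψ : Continuous ψ) (hB : ∀ x, ‖x‖ ≤ c x + B) {t : ℝ} (ht : 0 < t)
    (x : EuclideanSpace ℝ (Fin d)) : ∃ y, φ (t, x) = -ψ y + t * c (-(t⁻¹ • (x - y))) := by
  have hcont : Continuous fun y => -ψ y + t * c (-(t⁻¹ • (x - y))) := by fun_prop
  have hlim : Filter.Tendsto (fun y => -ψ y + t * c (-(t⁻¹ • (x - y))))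
      (Filter.cocompact _) Filter.atTop := by
    refine Filter.tendsto_atTop_mono (f := fun y => ‖y‖ + -(‖x‖ + M + t * B)) (fun y => ?_)
      (Filter.tendsto_atTop_add_const_right _ _ tendsto_norm_cocompact_atTop)
    have h1 := hB (-(t⁻¹ • (x - y)))
    have h2 := (abs_le.1 (hψbdd y)).2
    rw [norm_neg, norm_smul, norm_inv, Real.norm_of_nonneg ht.le, inv_mul_le_iff₀ ht] at h1
    have h3 := norm_sub_norm_le y x
    rw [norm_sub_rev] at h3
    linarith
  obtain ⟨y, hy⟩ := hcont.exists_forall_le hlim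
  refine ⟨y, (potential_le hφ hnonneg ht x y).antisymm ?_⟩
  rw [← EReal.coe_le_coe_iff, hφ _ (show (0 : ℝ) ≤ t from ht.le)]
  refine le_iInf fun y' => ?_
  rw [potential_term hnonneg ht, EReal.coe_le_coe_iff]
  exact hy y'

theorem hopfLax_potential (hconv : ConvexOn ℝ univ c) (hnonneg : ∀ x, 0 ≤ c x)
    (hsuper : Filter.Tendsto (fun x => c x / ‖x‖)
      (Bornology.cobounded (EuclideanSpace ℝ (Fin d))) Filter.atTop)
    {M : ℝ} (hψbdd : ∀ y, |ψ y| ≤ M) {K : NNReal} (hψlip : LipschitzWith K ψ) :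
    HopfLax (fun w => c (-w)) (fun t x => φ (t, x)) := by
  have hc : Continuous c := continuousOn_univ.1 (hconv.continuousOn isOpen_univ)
  obtain ⟨B, hB0, hB⟩ := exists_norm_le_add hnonneg hsuper
  have hM : 0 ≤ M := (abs_nonneg _).trans (hψbdd 0)
  have hzero := potential_zero hφ
  have hle := fun {t : ℝ} (ht : 0 < t) => potential_le hφ hnonneg ht
  have hex := fun {t : ℝ} (ht : 0 < t) =>
    exists_potential_eq hφ hnonneg hc hψbdd hψlip.continuous hB ht
  have hbd : ∀ t, 0 ≤ t → ∀ x, |φ (t, x)| ≤ M + t * c 0 := by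
    intro t ht x
    rcases ht.eq_or_lt with rfl | ht
    · simpa [hzero] using hψbdd x
    · have h1 := hle ht x x
      obtain ⟨y, hy⟩ := hex ht x
      have h2 := mul_nonneg ht.le (hnonneg (-(t⁻¹ • (x - y))))
      have h3 := mul_nonneg ht.le (hnonneg 0)
      simp only [sub_self, smul_zero, neg_zero] at h1
      have h4 := abs_le.1 (hψbdd x)
      have h5 := abs_le.1 (hψbdd y)
      exact abs_le.2 ⟨by linarith, by linarith⟩
  constructor
  · exact hconv.comp_linearMap
      (-LinearMap.id : EuclideanSpace ℝ (Fin d) →ₗ[ℝ] EuclideanSpace ℝ (Fin d))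
  · exact fun w => hnonneg _
  · fun_prop
  · intro s τ hs hτ y w
    rcases hs.eq_or_lt with rfl | hs
    · have := hle hτ (y + τ • w) y
      rw [add_sub_cancel_left, inv_smul_smul₀ hτ.ne'] at this
      simpa [hzero] using this
    · obtain ⟨y₀, hy₀⟩ := hex hs y
      have h1 := hle (add_pos hs hτ) (y + τ • w) y₀
      have hst : 0 < s + τ := by positivity
      have h2 := hconv.2 (mem_univ (-(s⁻¹ • (y - y₀)))) (mem_univ (-w))
        (show 0 ≤ s / (s + τ) by positivity) (show 0 ≤ τ / (s + τ) by positivity)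
        (by field_simp)
      have e : (s / (s + τ)) • (-(s⁻¹ • (y - y₀))) + (τ / (s + τ)) • (-w) =
          -((s + τ)⁻¹ • (y + τ • w - y₀)) := by
        match_scalars <;> field_simp
      rw [e] at h2
      simp only [smul_eq_mul] at h2
      have h3 := mul_le_mul_of_nonneg_left h2 hst.le
      have e2 : (s + τ) * (s / (s + τ) * c (-(s⁻¹ • (y - y₀))) + τ / (s + τ) * c (-w)) =
          s * c (-(s⁻¹ • (y - y₀))) + τ * c (-w) := by field_simp
      rw [e2] at h3
      linarith
  · intro t ht
    rcases ht.eq_or_lt with rfl | ht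
    · simp only [hzero]
      exact hψlip.continuous.neg
    · refine (LipschitzWith.of_le_add_mul K fun x x' => ?_).continuous
      obtain ⟨y, hy⟩ := hex ht x'
      have h1 := hle ht x (y + (x - x'))
      have e : x - (y + (x - x')) = x' - y := by abel
      rw [e] at h1
      have h2 := hψlip.dist_le_mul y (y + (x - x'))
      rw [dist_self_add_right, ← dist_eq_norm, Real.dist_eq] at h2
      have h3 := (abs_le.1 h2).2
      linarith
  · exact fun t ht => ⟨_, hbd t ht⟩
  · intro t ht x
    obtain ⟨y, hy⟩ := hex ht x
    refine ⟨t⁻¹ • (x - y), ?_⟩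
    unfold BackDir
    simp only [sub_self, smul_inv_smul₀ ht.ne', sub_sub_cancel, hzero]
    exact hy
  · intro t₀ ht₀
    refine ⟨2 * M / t₀ + c 0 + B, fun t ht x u hu => ?_⟩
    have ht0 : 0 < t := ht₀.trans_le ht
    unfold BackDir at hu
    simp only [sub_self, hzero] at hu
    have h1 := (abs_le.1 (hbd t ht0.le x)).2
    have h2 := (abs_le.1 (hψbdd (x - t • u))).2
    have h3 := hB (-u)
    rw [norm_neg] at h3
    have h4 : c (-u) ≤ 2 * M / t + c 0 := by
      rw [← sub_le_iff_le_add, le_div_iff₀ ht0]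
      linarith
    have h5 : 2 * M / t ≤ 2 * M / t₀ := by gcongr
    linarith

end

end HopfLaxFormula

/-- Almost everywhere regularity of the space-time potential on the time-1 slice:
`H^d`-almost every point of `{1} × ℝ^d` is regular for `φ̄`. -/
theorem ae_regularity_on_time_one_slice {d : ℕ}
    (c : EuclideanSpace ℝ (Fin d) → ℝ)
    (hconv : ConvexOn ℝ univ c) (hnonneg : ∀ x, 0 ≤ c x)
    (hsuper : Filter.Tendsto (fun x => c x / ‖x‖)
      (Bornology.cobounded (EuclideanSpace ℝ (Fin d))) Filter.atTop)
    (ψ : EuclideanSpace ℝ (Fin d) → ℝ) (M : ℝ) (hψbdd : ∀ y, |ψ y| ≤ M)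
    (K : NNReal) (hψlip : LipschitzWith K ψ)
    (φ : Spt d → ℝ)
    (hφ : ∀ z ∈ Dom d, ((φ z : ℝ) : EReal) =
      ⨅ y : EuclideanSpace ℝ (Fin d),
        (((-ψ y : ℝ)) : EReal) + (cbar c (z - ((0 : ℝ), y)) : EReal)) :
    μH[(d : ℝ)] ({z : Spt d | z.1 = 1} \ Rreg c φ) = 0 := by
  have H := hopfLax_potential hφ hconv hnonneg hsuper hψbdd hψlip
  refine measure_mono_null ?_
    (hausdorffMeasure_slice_eq_zero (ae_iff.1 (H.ae_exists_relint_ray volume one_pos)) 1)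
  rintro ⟨t, x⟩ ⟨rfl, hx⟩
  exact ⟨x, fun h => hx (mem_Rreg_of_relint_rays hnonneg rfl rfl one_pos h.1 h.2.1 h.2.2), rfl⟩

end
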